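/- Let V ⊆ ℝ_{>0}^n × ℝ^m be a closed semialgebraic set. Then there exists a finite collection Σ of strongly convex rational polyhedral cones in ℝ^n such that: every face of a cone in Σ belongs to Σ; the intersection of any two cones in Σ is a face of each of them; the union of the cones in Σ equals Trop(V); and moreover (1) for all σ, τ ∈ Σ with σ ⊆ τ, L_τ(V) equals the relative limit set L_{σ,τ}(L_σ(V)); and (2) for every σ ∈ Σ and every strongly convex (possibly non-rational) cone σ' ⊆ σ with σ' ∩ relint(σ) ≠ ∅, one has L_{σ'}(V) = (ρ_{σ',σ} × id_{ℝ^m})^{−1}(L_σ(V)), where ρ_{σ',σ} : O(σ')(ℝ_{>0}) → O(σ)(ℝ_{>0}) is the restriction map φ ↦ φ|_{σ^⊥}; in particular L_{σ'}(V) is the trivial ℝ_{>0}^{dim σ − dim σ'}-bundle over L_σ(V). -/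

import Mathlib

open Filter Topology

noncomputable section

/-- A closed semialgebraic subset of `ℝ^n × ℝ^m`: a finite union of sets of the form
`{x : p₁(x) ≥ 0, …, p_k(x) ≥ 0}` for real polynomials `p_i`. -/
def IsClosedSemialgebraic (n m : ℕ) (S : Set ((Fin n → ℝ) × (Fin m → ℝ))) : Prop :=
  ∃ (k : ℕ) (P : Fin k → Finset (MvPolynomial (Fin n ⊕ Fin m) ℝ)),
    S = ⋃ j : Fin k, {p | ∀ q ∈ P j, 0 ≤ MvPolynomial.eval (Sum.elim p.1 p.2) q}

/-- A closed semialgebraic subset of `ℝ_{>0}^n × ℝ^m`. -/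
def IsClosedSemialgebraicInOrthant (n m : ℕ) (V : Set ((Fin n → ℝ) × (Fin m → ℝ))) : Prop :=
  ∃ W, IsClosedSemialgebraic n m W ∧ V = {p | ∀ i, 0 < p.1 i} ∩ W

/-- The standard pairing of `ℝ^n` with its dual, both identified with `Fin n → ℝ`. -/
def dotR {n : ℕ} (w x : Fin n → ℝ) : ℝ := ∑ i, w i * x i

/-- `σ^⊥`: the annihilator of `σ` in the dual space. -/
def perpSet {n : ℕ} (σ : Set (Fin n → ℝ)) : Set (Fin n → ℝ) := {w | ∀ x ∈ σ, dotR w x = 0}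

/-- `σ^∨`: the dual cone of `σ`. -/
def dualSet {n : ℕ} (σ : Set (Fin n → ℝ)) : Set (Fin n → ℝ) := {w | ∀ x ∈ σ, 0 ≤ dotR w x}

/-- The monomial `x^w := ∏ᵢ xᵢ^{wᵢ}` (real exponents). -/
def mPow {n : ℕ} (x w : Fin n → ℝ) : ℝ := ∏ i, x i ^ w i

/-- The positive torus orbit `O(σ)(ℝ_{>0})`: functions `φ : σ^⊥ → ℝ_{>0}` of the form
`φ(w) = e^{ℓ(w)}` for an `ℝ`-linear functional `ℓ` on `σ^⊥` (represented by a vector `v`). -/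
def orbitSet {n : ℕ} (σ : Set (Fin n → ℝ)) : Set (↥(perpSet σ) → ℝ) :=
  {φ | ∃ v : Fin n → ℝ, ∀ w : ↥(perpSet σ), φ w = Real.exp (dotR v (w : Fin n → ℝ))}

/-- The limit set `L_σ(V) ⊆ O(σ)(ℝ_{>0}) × ℝ^m`: pairs `(φ, z)` with `φ` an orbit point,
such that some sequence `(x⁽ᵏ⁾, z⁽ᵏ⁾) ∈ V` has `z⁽ᵏ⁾ → z` and, for all `w ∈ σ^∨`,
`(x⁽ᵏ⁾)^w → φ(w)` if `w ∈ σ^⊥` and `(x⁽ᵏ⁾)^w → 0` if `w ∈ σ^∨ ∖ σ^⊥`. -/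
def limitSet {n : ℕ} (m : ℕ) (σ : Set (Fin n → ℝ))
    (V : Set ((Fin n → ℝ) × (Fin m → ℝ))) :
    Set ((↥(perpSet σ) → ℝ) × (Fin m → ℝ)) :=
  {p | p.1 ∈ orbitSet σ ∧
    ∃ u : ℕ → (Fin n → ℝ) × (Fin m → ℝ),
      (∀ k, u k ∈ V) ∧
      Tendsto (fun k => (u k).2) atTop (𝓝 p.2) ∧
      (∀ w (_hw : w ∈ dualSet σ) (hw' : w ∈ perpSet σ),
        Tendsto (fun k => mPow (u k).1 w) atTop (𝓝 (p.1 ⟨w, hw'⟩))) ∧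
      (∀ w, w ∈ dualSet σ → w ∉ perpSet σ →
        Tendsto (fun k => mPow (u k).1 w) atTop (𝓝 0))}

/-- The relative limit set `L_{σ,τ}(W) ⊆ O(τ)(ℝ_{>0}) × ℝ^m` of a subset
`W ⊆ O(σ)(ℝ_{>0}) × ℝ^m`, for cones `σ ⊆ τ`: pairs `(φ, z)` with `φ` an orbit point of
`τ`, such that some sequence `(ψ⁽ᵏ⁾, z⁽ᵏ⁾) ∈ W` has `z⁽ᵏ⁾ → z` and, for all
`w ∈ τ^∨ ∩ σ^⊥`, `ψ⁽ᵏ⁾(w) → φ(w)` if `w ∈ τ^⊥` and `ψ⁽ᵏ⁾(w) → 0` otherwise. -/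
def relLimitSet {n : ℕ} (m : ℕ) (σ τ : Set (Fin n → ℝ))
    (W : Set ((↥(perpSet σ) → ℝ) × (Fin m → ℝ))) :
    Set ((↥(perpSet τ) → ℝ) × (Fin m → ℝ)) :=
  {p | p.1 ∈ orbitSet τ ∧
    ∃ u : ℕ → (↥(perpSet σ) → ℝ) × (Fin m → ℝ),
      (∀ k, u k ∈ W) ∧
      Tendsto (fun k => (u k).2) atTop (𝓝 p.2) ∧
      (∀ w (_hw : w ∈ dualSet τ) (hwσ : w ∈ perpSet σ) (hwτ : w ∈ perpSet τ),
        Tendsto (fun k => (u k).1 ⟨w, hwσ⟩) atTop (𝓝 (p.1 ⟨w, hwτ⟩))) ∧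
      (∀ w (_hw : w ∈ dualSet τ) (hwσ : w ∈ perpSet σ), w ∉ perpSet τ →
        Tendsto (fun k => (u k).1 ⟨w, hwσ⟩) atTop (𝓝 0))}

/-- The restriction map `ρ_{σ',σ} : O(σ')(ℝ_{>0}) → O(σ)(ℝ_{>0})`, `φ ↦ φ|_{σ^⊥}`,
for `σ' ⊆ σ` (so that `σ^⊥ ⊆ σ'^⊥`). -/
def restrictOrbit {n : ℕ} (σ' σ : Set (Fin n → ℝ)) (h : σ' ⊆ σ)
    (φ : ↥(perpSet σ') → ℝ) : ↥(perpSet σ) → ℝ :=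
  fun w => φ ⟨(w : Fin n → ℝ), fun x hx => w.2 x (h hx)⟩

/-- A strongly convex closed convex cone: a closed convex cone (containing `0`) that
contains no line. It may be non-rational. -/
def IsSCCone {n : ℕ} (σ : Set (Fin n → ℝ)) : Prop :=
  IsClosed σ ∧ Convex ℝ σ ∧ (0 : Fin n → ℝ) ∈ σ ∧
    (∀ x ∈ σ, ∀ c : ℝ, 0 ≤ c → c • x ∈ σ) ∧ (∀ x ∈ σ, -x ∈ σ → x = 0)

/-- `σ ⊆ ℝ^n` is a rational polyhedral cone: the set of nonnegative real combinations of
finitely many rational vectors. -/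
def IsRatPolyCone {n : ℕ} (σ : Set (Fin n → ℝ)) : Prop :=
  ∃ (k : ℕ) (v : Fin k → Fin n → ℚ),
    σ = {x | ∃ lam : Fin k → ℝ, (∀ u, 0 ≤ lam u) ∧
      x = ∑ u, lam u • fun i => ((v u i : ℝ))}

/-- `τ` is a face of the cone `σ`: the locus in `σ` where some linear functional that is
nonnegative on `σ` vanishes. -/
def IsFaceOf {n : ℕ} (τ σ : Set (Fin n → ℝ)) : Prop :=
  ∃ w : Fin n → ℝ, (∀ x ∈ σ, 0 ≤ dotR w x) ∧ τ = {x | x ∈ σ ∧ dotR w x = 0}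

/-- The tropicalization `Trop(V) ⊆ ℝ^n` of `V ⊆ ℝ_{>0}^n × ℝ^m`: all `w` such that
`−ε_k·(log x₁⁽ᵏ⁾, …, log x_n⁽ᵏ⁾) → w` for some points `(x⁽ᵏ⁾, z⁽ᵏ⁾) ∈ V` and positive
reals `ε_k → 0` (Alessandrini's logarithmic limit set). -/
def tropSet (n m : ℕ) (V : Set ((Fin n → ℝ) × (Fin m → ℝ))) : Set (Fin n → ℝ) :=
  {w | ∃ (u : ℕ → (Fin n → ℝ) × (Fin m → ℝ)) (e : ℕ → ℝ),
    (∀ k, u k ∈ V) ∧ (∀ k, 0 < e k) ∧ Tendsto e atTop (𝓝 0) ∧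
    Tendsto (fun k => fun i => -(e k) * Real.log ((u k).1 i)) atTop (𝓝 w)}

open Filter Topology

/-- compat -/
def Compat (S : Finset (ℝ × ℝ)) (y y' : ℝ) : Prop :=
  ∀ a ∈ S, (y < a.1 ↔ y' < a.2) ∧ (a.1 < y ↔ a.2 < y')

def PIso (S : Finset (ℝ × ℝ)) : Prop := ∀ a ∈ S, Compat S a.1 a.2

lemma Compat.eq_iff {S : Finset (ℝ × ℝ)} {y y' : ℝ} (h : Compat S y y') {a : ℝ × ℝ} (ha : a ∈ S) :
    y = a.1 ↔ y' = a.2 := by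
  have := h a ha
  constructor
  · intro e
    apply le_antisymm
    · by_contra hc
      push Not at hc
      exact absurd (this.2.2 hc) (by simp [e])
    · by_contra hc
      push Not at hc
      exact absurd (this.1.2 hc) (by simp [e])
  · intro e
    apply le_antisymm
    · by_contra hc
      push Not at hc
      exact absurd (this.2.1 hc) (by simp [e])
    · by_contra hc
      push Not at hc
      exact absurd (this.1.1 hc) (by simp [e])

lemma compat_exists {S : Finset (ℝ × ℝ)} (hS : PIso S) (y : ℝ) : ∃ y', Compat S y y' := by
  classical
  by_cases h : ∃ a ∈ S, a.1 = y
  · obtain ⟨a, ha, rfl⟩ := h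
    exact ⟨a.2, hS a ha⟩
  · push Not at h
    obtain ⟨m, h1, h2⟩ := Order.exists_between_finsets
      ((S.filter (fun a => a.1 < y)).image Prod.snd) ((S.filter (fun a => y < a.1)).image Prod.snd)
      (by
        intro x hx z hz
        simp only [Finset.mem_image, Finset.mem_filter] at hx hz
        obtain ⟨a, ⟨ha, hay⟩, rfl⟩ := hx
        obtain ⟨b, ⟨hb, hby⟩, rfl⟩ := hz
        exact ((hS a ha) b hb).1.1 (hay.trans hby))
    refine ⟨m, fun a ha => ?_⟩
    rcases lt_or_gt_of_ne (h a ha) with hlt | hlt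
    · have := h1 a.2 (Finset.mem_image.2 ⟨a, Finset.mem_filter.2 ⟨ha, hlt⟩, rfl⟩)
      constructor <;> constructor <;> intro <;> first | assumption | (exfalso; linarith)
    · have := h2 a.2 (Finset.mem_image.2 ⟨a, Finset.mem_filter.2 ⟨ha, hlt⟩, rfl⟩)
      constructor <;> constructor <;> intro <;> first | assumption | (exfalso; linarith)

lemma compat_between {S : Finset (ℝ × ℝ)} {c d e y' : ℝ} (hc : Compat S c y') (hd : Compat S d y')
    (h1 : c ≤ e) (h2 : e ≤ d) : Compat S e y' := by
  intro a ha
  have h3 := hc a ha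
  have h4 := hd a ha
  refine ⟨⟨fun h => h3.1.1 (by linarith), fun h => ?_⟩, ⟨fun h => h4.2.1 (by linarith), fun h => ?_⟩⟩
  · have := h4.1.2 h; linarith
  · have := h3.2.2 h; linarith

def swapS (S : Finset (ℝ × ℝ)) : Finset (ℝ × ℝ) := S.map (Equiv.prodComm ℝ ℝ).toEmbedding

lemma mem_swapS {S : Finset (ℝ × ℝ)} {a : ℝ × ℝ} : a ∈ swapS S ↔ (a.2, a.1) ∈ S := by
  simp only [swapS, Finset.mem_map_equiv]
  rfl

lemma compat_swap {S : Finset (ℝ × ℝ)} {y y' : ℝ} : Compat (swapS S) y' y ↔ Compat S y y' := by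
  constructor
  · intro h a ha
    have := h (a.2, a.1) (mem_swapS.2 ha)
    exact ⟨this.1.symm, this.2.symm⟩
  · intro h a ha
    have := h (a.2, a.1) (mem_swapS.1 ha)
    exact ⟨this.1.symm, this.2.symm⟩

def negS (S : Finset (ℝ × ℝ)) : Finset (ℝ × ℝ) := S.map (Equiv.neg (ℝ × ℝ)).toEmbedding

lemma mem_negS {S : Finset (ℝ × ℝ)} {a : ℝ × ℝ} : a ∈ negS S ↔ -a ∈ S := by
  simp only [negS, Finset.mem_map_equiv]
  rfl

lemma compat_neg {S : Finset (ℝ × ℝ)} {y y' : ℝ} (h : Compat S y y') :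
    Compat (negS S) (-y) (-y') := by
  intro a ha
  have := h (-a) (mem_negS.1 ha)
  simp only [Prod.fst_neg, Prod.snd_neg] at this
  constructor
  · rw [neg_lt, this.2, neg_lt]
  · rw [lt_neg, this.1, lt_neg]

lemma negS_negS (S : Finset (ℝ × ℝ)) : negS (negS S) = S := by
  ext a; simp [mem_negS]

lemma compat_neg' {S : Finset (ℝ × ℝ)} {y y' : ℝ} (h : Compat (negS S) (-y) (-y')) :
    Compat S y y' := by
  have := compat_neg h
  simpa [negS_negS] using this

lemma gap_open {S : Finset (ℝ × ℝ)} {y y' : ℝ} (h : Compat S y y') (hn : ∀ a ∈ S, y ≠ a.1) :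
    ∀ᶠ c in 𝓝 y, Compat S c y' := by
  have : ∀ a ∈ S, ∀ᶠ c in 𝓝 y, (c < a.1 ↔ y' < a.2) ∧ (a.1 < c ↔ a.2 < y') := by
    intro a ha
    rcases lt_or_gt_of_ne (hn a ha) with hlt | hlt
    · filter_upwards [eventually_lt_nhds hlt] with c hc
      have := (h a ha).1.1 hlt
      constructor <;> constructor <;> intro <;> first | assumption | (exfalso; linarith)
    · filter_upwards [eventually_gt_nhds hlt] with c hc
      have := (h a ha).2.1 hlt
      constructor <;> constructor <;> intro <;> first | assumption | (exfalso; linarith)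
  exact (Filter.eventually_all_finset S).2 this

/-- Good function data. -/
structure GF (f f' : ℝ → ℝ) : Prop where
  der : ∀ x, HasDerivAt f (f' x) x
  top : Tendsto (fun x => |f x|) atTop atTop
  bot : Tendsto (fun x => |f x|) atBot atTop
  nz : ∀ a b, a < b → ∃ c, a < c ∧ c < b ∧ f' c ≠ 0

lemma GF.neg {f f' : ℝ → ℝ} (h : GF f f') : GF (fun x => - f x) (fun x => - f' x) :=
  ⟨fun x => (h.der x).neg, by simpa using h.top, by simpa using h.bot, fun a b hab => by
    obtain ⟨c, h1, h2, h3⟩ := h.nz a b hab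
    exact ⟨c, h1, h2, by simpa using h3⟩⟩

lemma GF.refl {f f' : ℝ → ℝ} (h : GF f f') : GF (fun x => - f (-x)) (fun x => f' (-x)) :=
  ⟨fun x => by
      have := ((h.der (-x)).comp x (hasDerivAt_neg x)).neg
      rw [mul_neg_one, neg_neg] at this
      exact this,
      by simpa [Function.comp_def] using h.bot.comp tendsto_neg_atTop_atBot,
      by simpa [Function.comp_def] using h.top.comp tendsto_neg_atBot_atTop, fun a b hab => by
    obtain ⟨c, h1, h2, h3⟩ := h.nz (-b) (-a) (by linarith)
    exact ⟨-c, by linarith, by linarith, by simpa using h3⟩⟩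

lemma GF.mono {f f' : ℝ → ℝ} (h : GF f f') {a b : ℝ} (hab : a < b) (hp : ∀ x, a < x → x < b → 0 < f' x) :
    f a < f b := by
  have : StrictMonoOn f (Set.Icc a b) := by
    apply strictMonoOn_of_deriv_pos (convex_Icc a b)
    · exact fun x _ => (h.der x).continuousAt.continuousWithinAt
    · intro x hx
      rw [interior_Icc] at hx
      rw [(h.der x).deriv]
      exact hp x hx.1 hx.2
  exact this ⟨le_rfl, hab.le⟩ ⟨hab.le, le_rfl⟩ hab

lemma sign_pos_of {a b : ℝ} (h : SignType.sign a = SignType.sign b) (ha : 0 < a) : 0 < b := by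
  rw [sign_pos ha] at h
  exact sign_eq_one_iff.1 h.symm

lemma sign_neg_of {a b : ℝ} (h : SignType.sign a = SignType.sign b) (ha : a < 0) : b < 0 := by
  rw [sign_neg ha] at h
  exact sign_eq_neg_one_iff.1 h.symm

lemma sign_zero_of {a b : ℝ} (h : SignType.sign a = SignType.sign b) (ha : a = 0) : b = 0 := by
  rw [ha, sign_zero] at h
  exact sign_eq_zero_iff.1 h.symm

/-- hypotheses of the extension step -/
structure EH (S : Finset (ℝ × ℝ)) (f f' g g' : ℝ → ℝ) : Prop where
  gf : GF f f'
  gg : GF g g'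
  h1 : ∀ y y', Compat S y y' → SignType.sign (f' y) = SignType.sign (g' y')
  h2 : ∀ a ∈ S, SignType.sign (f a.1) = SignType.sign (g a.2)

lemma EH.swap {S : Finset (ℝ × ℝ)} {f f' g g' : ℝ → ℝ} (h : EH S f f' g g') :
    EH (swapS S) g g' f f' :=
  ⟨h.gg, h.gf, fun y y' hy => (h.h1 y' y (compat_swap.1 hy)).symm,
    fun a ha => (h.h2 _ (mem_swapS.1 ha)).symm⟩

lemma EH.neg {S : Finset (ℝ × ℝ)} {f f' g g' : ℝ → ℝ} (h : EH S f f' g g') :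
    EH S (fun x => - f x) (fun x => - f' x) (fun x => - g x) (fun x => - g' x) :=
  ⟨h.gf.neg, h.gg.neg, fun y y' hy => by simp [Left.sign_neg, h.h1 y y' hy],
    fun a ha => by simp [Left.sign_neg, h.h2 a ha]⟩

lemma EH.refl {S : Finset (ℝ × ℝ)} {f f' g g' : ℝ → ℝ} (h : EH S f f' g g') :
    EH (negS S) (fun x => - f (-x)) (fun x => f' (-x)) (fun x => - g (-x)) (fun x => g' (-x)) :=
  ⟨h.gf.refl, h.gg.refl, fun y y' hy => by
      have := compat_neg hy
      rw [negS_negS] at this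
      exact h.h1 _ _ this,
    fun a ha => by
      have := h.h2 _ (mem_negS.1 ha)
      simp only [Left.sign_neg]
      simpa using this⟩

lemma neg_transfer {S : Finset (ℝ × ℝ)} {f f' g g' : ℝ → ℝ} (H : EH S f f' g g') (hS : PIso S)
    {y y' : ℝ} (hy : Compat S y y') (hn : ∀ a ∈ S, y ≠ a.1) (hD : 0 < f' y)
    (hc : ∃ c, Compat S c y' ∧ f c < 0) : ∃ c', Compat S y c' ∧ g c' < 0 := by
  have hn' : ∀ a ∈ S, y' ≠ a.2 := fun a ha e => hn a ha ((hy.eq_iff ha).2 e)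
  have hD' : 0 < g' y' := sign_pos_of (H.h1 _ _ hy) hD
  have hfD : ∀ c, Compat S c y' → 0 < f' c := fun c hc => sign_pos_of (H.h1 _ _ hc).symm hD'
  have hgD : ∀ c, Compat S y c → 0 < g' c := fun c hc => sign_pos_of (H.h1 _ _ hc) hD
  obtain ⟨c, hc, hfc⟩ := hc
  by_cases hl : ∃ a ∈ S, a.1 < y
  · obtain ⟨a, ha, hmax⟩ := Finset.exists_max_image (S.filter (fun a => a.1 < y)) Prod.fst
      (by obtain ⟨a, ha, h⟩ := hl; exact ⟨a, Finset.mem_filter.2 ⟨ha, h⟩⟩)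
    rw [Finset.mem_filter] at ha
    have ha2 : a.2 < y' := (hy a ha.1).2.1 ha.2
    have hac : a.1 < c := (hc a ha.1).2.2 ha2
    have hmax' : ∀ b ∈ S, b.1 < y → b.1 ≤ a.1 := fun b hb h => hmax b (Finset.mem_filter.2 ⟨hb, h⟩)
    have hgap : ∀ e, a.1 < e → e < c → Compat S e y' := by
      intro e h1 h2 b hb
      rcases lt_or_gt_of_ne (hn b hb) with hlt | hlt
      · have h3 := (hy b hb).1.1 hlt
        have h4 := (hc b hb).1.2 h3
        constructor <;> constructor <;> intro <;> first | assumption | linarith | (exfalso; linarith)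
      · have h3 := (hy b hb).2.1 hlt
        have h4 := hmax' b hb hlt
        constructor <;> constructor <;> intro <;> first | assumption | linarith | (exfalso; linarith)
    have hfa : f a.1 < 0 := (H.gf.mono hac (fun x h1 h2 => hfD x (hgap x h1 h2))).trans hfc
    have hga : g a.2 < 0 := sign_neg_of (H.h2 a ha.1) hfa
    have h5 : ∀ᶠ x in 𝓝[>] a.2, g x < 0 :=
      (((H.gg.der a.2).continuousAt.tendsto).eventually (eventually_lt_nhds hga)).filter_mono
        nhdsWithin_le_nhds
    have h6 : ∀ᶠ x in 𝓝[>] a.2, x < y' ∧ a.2 < x :=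
      ((eventually_lt_nhds ha2).filter_mono nhdsWithin_le_nhds).and self_mem_nhdsWithin
    obtain ⟨x, hx1, hx2, hx3⟩ := (h5.and h6).exists
    refine ⟨x, ?_, hx1⟩
    intro b hb
    rcases lt_or_gt_of_ne (hn b hb) with hlt | hlt
    · have h3 := (hy b hb).1.1 hlt
      constructor <;> constructor <;> intro <;> first | assumption | linarith | (exfalso; linarith)
    · have h3 := (hy b hb).2.1 hlt
      have h4 := hmax' b hb hlt
      have h5 : b.2 ≤ a.2 := by
        by_contra hcon
        push Not at hcon
        have := ((hS a ha.1) b hb).1.2 hcon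
        linarith
      constructor <;> constructor <;> intro <;> first | assumption | linarith | (exfalso; linarith)
  · push Not at hl
    have hall : ∀ e, e ≤ y' → Compat S y e := by
      intro e he b hb
      have hlt : y < b.1 := lt_of_le_of_ne (hl b hb) (hn b hb)
      have h3 := (hy b hb).1.1 hlt
      constructor <;> constructor <;> intro <;> first | assumption | linarith | (exfalso; linarith)
    obtain ⟨e, he1, he2⟩ := ((H.gg.bot.eventually_gt_atTop |g y'|).and (eventually_lt_atBot y')).exists
    refine ⟨e, hall e he2.le, ?_⟩
    have := H.gg.mono he2 (fun x _ h2 => hgD x (hall x h2.le))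
    by_contra hcon
    push Not at hcon
    rw [abs_of_nonneg hcon, abs_of_nonneg (hcon.trans this.le)] at he1
    linarith

lemma pos_transfer {S : Finset (ℝ × ℝ)} {f f' g g' : ℝ → ℝ} (H : EH S f f' g g') (hS : PIso S)
    {y y' : ℝ} (hy : Compat S y y') (hn : ∀ a ∈ S, y ≠ a.1) (hD : 0 < f' y)
    (hc : ∃ c, Compat S c y' ∧ 0 < f c) : ∃ c', Compat S y c' ∧ 0 < g c' := by
  obtain ⟨c, hc, hfc⟩ := hc
  obtain ⟨c', h1, h2⟩ := neg_transfer H.refl (fun a ha => by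
      have := compat_neg (hS _ (mem_negS.1 ha)); simpa using this) (compat_neg hy)
    (fun a ha e => hn _ (mem_negS.1 ha) (by simp [← e])) (by simpa using hD)
    ⟨-c, compat_neg hc, by simpa using hfc⟩
  refine ⟨-c', compat_neg' (by simpa using h1), by simpa using h2⟩

lemma root_between {f f' : ℝ → ℝ} (h : GF f f') {a b : ℝ} (ha : f a < 0) (hb : 0 < f b) :
    ∃ r, f r = 0 ∧ r ∈ Set.uIcc a b := by
  have : (0:ℝ) ∈ Set.uIcc (f a) (f b) := by
    rw [Set.mem_uIcc]; left; exact ⟨ha.le, hb.le⟩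
  obtain ⟨r, h1, h2⟩ := intermediate_value_uIcc
    (fun x _ => (h.der x).continuousAt.continuousWithinAt) this
  exact ⟨r, h2, h1⟩

lemma compat_uIcc {S : Finset (ℝ × ℝ)} {c d e y' : ℝ} (hc : Compat S c y') (hd : Compat S d y')
    (h : e ∈ Set.uIcc c d) : Compat S e y' := by
  rcases Set.mem_uIcc.1 h with h | h
  · exact compat_between hc hd h.1 h.2
  · exact compat_between hd hc h.1 h.2

lemma compat_uIcc' {S : Finset (ℝ × ℝ)} {c d e y' : ℝ} (hc : Compat S y' c) (hd : Compat S y' d)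
    (h : e ∈ Set.uIcc c d) : Compat S y' e :=
  compat_swap.1 (compat_uIcc (compat_swap.2 hc) (compat_swap.2 hd) h)

/-- zero case -/
lemma zero_case {S : Finset (ℝ × ℝ)} {f f' g g' : ℝ → ℝ} (H : EH S f f' g g') (hS : PIso S)
    {y y' : ℝ} (hy : Compat S y y') (hn : ∀ a ∈ S, y ≠ a.1) (hD : 0 < f' y) (h0 : f y = 0) :
    ∃ r', Compat S y r' ∧ g r' = 0 := by
  have hD' : 0 < g' y' := sign_pos_of (H.h1 _ _ hy) hD
  have hfD : ∀ c, Compat S c y' → 0 < f' c := fun c hc => sign_pos_of (H.h1 _ _ hc).symm hD'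
  have ho := gap_open hy hn
  obtain ⟨l, hl1, hl2⟩ := ((ho.filter_mono (nhdsWithin_le_nhds (s := Set.Iio y))).and
    self_mem_nhdsWithin).exists
  obtain ⟨r, hr1, hr2⟩ := ((ho.filter_mono (nhdsWithin_le_nhds (s := Set.Ioi y))).and
    self_mem_nhdsWithin).exists
  obtain ⟨l', hl', hl''⟩ := neg_transfer H hS hy hn hD ⟨l, hl1, by
    rw [← h0]; exact H.gf.mono hl2 (fun x h1 h2 => hfD x (compat_between hl1 hy h1.le h2.le))⟩
  obtain ⟨r', hr', hr''⟩ := pos_transfer H hS hy hn hD ⟨r, hr1, by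
    rw [← h0]; exact H.gf.mono hr2 (fun x h1 h2 => hfD x (compat_between hy hr1 h1.le h2.le))⟩
  obtain ⟨q, hq, hq'⟩ := root_between H.gg hl'' hr''
  exact ⟨q, compat_uIcc' hl' hr' hq', hq⟩

lemma opp_case {S : Finset (ℝ × ℝ)} {f f' g g' : ℝ → ℝ} (H : EH S f f' g g') (hS : PIso S)
    {y y' : ℝ} (hy : Compat S y y') (hn : ∀ a ∈ S, y ≠ a.1) (hD : 0 < f' y) (h0 : 0 < f y)
    (h0' : g y' < 0) :
    ∃ r r', Compat S r r' ∧ f r = 0 ∧ g r' = 0 ∧ r < y ∧ y' < r' := by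
  have hn' : ∀ a ∈ S, y' ≠ a.2 := fun a ha e => hn a ha ((hy.eq_iff ha).2 e)
  have hD' : 0 < g' y' := sign_pos_of (H.h1 _ _ hy) hD
  have hfD : ∀ c, Compat S c y' → 0 < f' c := fun c hc => sign_pos_of (H.h1 _ _ hc).symm hD'
  have hgD : ∀ c, Compat S y c → 0 < g' c := fun c hc => sign_pos_of (H.h1 _ _ hc) hD
  obtain ⟨c', hc', hc''⟩ := pos_transfer H hS hy hn hD ⟨y, hy, h0⟩
  have hSs : PIso (swapS S) := fun a ha => compat_swap.2 (hS _ (mem_swapS.1 ha))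
  obtain ⟨c, hc, hcc⟩ := neg_transfer H.swap hSs (compat_swap.2 hy)
    (fun a ha => hn' _ (mem_swapS.1 ha)) hD' ⟨y', compat_swap.2 hy, h0'⟩
  rw [compat_swap] at hc
  obtain ⟨r, hr, hr'⟩ := root_between H.gf hcc h0
  obtain ⟨q, hq, hq'⟩ := root_between H.gg h0' hc''
  have hr2 := compat_uIcc hc hy hr'
  have hq2 := compat_uIcc' hy hc' hq'
  refine ⟨r, q, ?_, hr, hq, ?_, ?_⟩
  · intro a ha
    have e1 := hr2 a ha
    have e2 := hq2 a ha
    have e3 := hy a ha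
    exact ⟨by rw [e1.1, ← e3.1, e2.1], by rw [e1.2, ← e3.2, e2.2]⟩
  · by_contra hcon
    push Not at hcon
    rcases hcon.lt_or_eq with hlt | heq
    · have := H.gf.mono hlt (fun x h1 h2 => hfD x (compat_between hy hr2 h1.le h2.le))
      linarith
    · rw [← heq] at hr; linarith
  · by_contra hcon
    push Not at hcon
    rcases hcon.lt_or_eq with hlt | heq
    · have := H.gg.mono hlt (fun x h1 h2 => hgD x (compat_uIcc' hq2 hy (Set.mem_uIcc.2 (Or.inl ⟨h1.le, h2.le⟩))))
      linarith
    · rw [heq] at hq; linarith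

lemma deriv_ne {S : Finset (ℝ × ℝ)} {f f' g g' : ℝ → ℝ} (H : EH S f f' g g')
    {y y' : ℝ} (hy : Compat S y y') (hn : ∀ a ∈ S, y ≠ a.1) : f' y ≠ 0 := by
  intro h0
  have h1 := sign_zero_of (H.h1 _ _ hy) h0
  obtain ⟨δ, hδ, hb⟩ := Metric.eventually_nhds_iff.1 (gap_open hy hn)
  obtain ⟨c, hc1, hc2, hc3⟩ := H.gf.nz y (y + δ) (by linarith)
  apply hc3
  exact sign_zero_of (H.h1 _ _ (hb (by rw [Real.dist_eq, abs_of_pos] <;> linarith))).symm h1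

/-- Two compatible root pairs are ordered the same. -/
lemma roots_order {S : Finset (ℝ × ℝ)} {f f' g g' : ℝ → ℝ} (H : EH S f f' g g')
    {r r' q q' : ℝ} (hr : Compat S r r') (hq : Compat S q q') (h1 : f r = 0)
    (h3 : f q = 0) (hlt : r < q) : r' < q' := by
  by_contra hcon
  push Not at hcon
  have hno : ∀ a ∈ S, r ≤ a.1 → a.1 ≤ q → False := by
    intro a ha h4 h5
    have h6 : r' ≤ a.2 := by
      by_contra h; push Not at h; have := (hr a ha).2.2 h; linarith
    have h7 : a.2 ≤ q' := by
      by_contra h; push Not at h; have := (hq a ha).1.2 h; linarith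
    have e1 := (hr.eq_iff ha).2 (by linarith)
    have e2 := (hq.eq_iff ha).2 (by linarith)
    linarith
  have hgap : ∀ e, r ≤ e → e ≤ q → Compat S e r' := by
    intro e h4 h5 a ha
    have h8 := hr a ha
    rcases lt_or_ge a.1 r with h6 | h6
    · have := h8.2.1 h6
      constructor <;> constructor <;> intro <;> first | assumption | linarith | (exfalso; linarith)
    · have h7 : q < a.1 := by
        by_contra h; push Not at h; exact hno a ha h6 h
      have := h8.1.1 (by linarith)
      constructor <;> constructor <;> intro <;> first | assumption | linarith | (exfalso; linarith)
  obtain ⟨c, hc, hc'⟩ := exists_hasDerivAt_eq_zero (f := f) (f' := f') hlt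
    (fun x _ => (H.gf.der x).continuousAt.continuousWithinAt) (by rw [h1, h3]) (fun x _ => H.gf.der x)
  exact deriv_ne H (hgap c hc.1.le hc.2.le) (fun a ha e => hno a ha (e ▸ hc.1.le) (e ▸ hc.2.le)) hc'

theorem extend_step {S : Finset (ℝ × ℝ)} {f f' g g' : ℝ → ℝ} (H : EH S f f' g g') (hS : PIso S)
    (hf : {x | f x = 0}.Finite) (hg : {x | g x = 0}.Finite) :
    ∃ S2, S ⊆ S2 ∧ PIso S2 ∧ (∀ a ∈ S2, a ∈ S ∨ (f a.1 = 0 ∧ g a.2 = 0)) ∧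
      ∀ y y', Compat S2 y y' → SignType.sign (f y) = SignType.sign (g y') := by
  classical
  let T : Finset (ℝ × ℝ) := (hf.toFinset ×ˢ hg.toFinset).filter (fun a => Compat S a.1 a.2)
  have hT : ∀ a, a ∈ T ↔ (f a.1 = 0 ∧ g a.2 = 0) ∧ Compat S a.1 a.2 := by
    intro a; simp [T]
  have hsw : ∀ {a b : ℝ × ℝ}, a ∈ T → b ∈ T → (a.1 < b.1 ↔ a.2 < b.2) := by
    intro a b ha hb
    rw [hT] at ha hb
    exact ⟨roots_order H ha.2 hb.2 ha.1.1 hb.1.1,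
      roots_order H.swap (compat_swap.2 ha.2) (compat_swap.2 hb.2) ha.1.2 hb.1.2⟩
  have hiso : PIso (S ∪ T) := by
    intro a ha b hb
    rcases Finset.mem_union.1 ha with ha | ha <;> rcases Finset.mem_union.1 hb with hb | hb
    · exact hS a ha b hb
    · have := ((hT b).1 hb).2 a ha
      exact ⟨this.2, this.1⟩
    · exact ((hT a).1 ha).2 b hb
    · exact ⟨hsw ha hb, hsw hb ha⟩
  refine ⟨S ∪ T, Finset.subset_union_left, hiso, ?_, ?_⟩
  · intro a ha
    rcases Finset.mem_union.1 ha with ha | ha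
    · exact Or.inl ha
    · exact Or.inr ((hT a).1 ha).1
  · intro y y' hyy
    have hy : Compat S y y' := fun a ha => hyy a (Finset.mem_union_left _ ha)
    by_cases hn : ∀ a ∈ S, y ≠ a.1
    swap
    · push Not at hn
      obtain ⟨a, ha, e⟩ := hn
      rw [e, (hy.eq_iff ha).1 e]
      exact H.h2 a ha
    -- main
    have hTm : ∀ r r', Compat S r r' → f r = 0 → g r' = 0 → (r, r') ∈ S ∪ T :=
      fun r r' h1 h2 h3 => Finset.mem_union_right _ ((hT _).2 ⟨⟨h2, h3⟩, h1⟩)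
    clear_value T
    have key : ∀ (S : Finset (ℝ × ℝ)) (f f' g g' : ℝ → ℝ) (y y' : ℝ) (U : Finset (ℝ × ℝ)), EH S f f' g g' → PIso S →
        Compat S y y' → Compat U y y' → (∀ a ∈ S, y ≠ a.1) → 
        (∀ r r', Compat S r r' → f r = 0 → g r' = 0 → (r, r') ∈ U) → (f y = 0 → g y' = 0) ∧
          ¬ (0 < f y ∧ g y' < 0) := by
      clear * -
      intro S f f' g g' y y' U H hS hy hU hn hU2
      have main : ∀ (f f' g g' : ℝ → ℝ), EH S f f' g g' → 0 < f' y → 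
        (∀ r r', Compat S r r' → f r = 0 → g r' = 0 → (r, r') ∈ U) → (f y = 0 → g y' = 0) ∧
          ¬ (0 < f y ∧ g y' < 0) ∧ ¬ (f y < 0 ∧ 0 < g y') := by
        intro f f' g g' H hD hU2
        have hD' : 0 < g' y' := sign_pos_of (H.h1 _ _ hy) hD
        have hn' : ∀ a ∈ S, y' ≠ a.2 := fun a ha e => hn a ha ((hy.eq_iff ha).2 e)
        refine ⟨fun h0 => ?_, fun h0 => ?_, fun h0 => ?_⟩
        · obtain ⟨r', h1, h2⟩ := zero_case H hS hy hn hD h0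
          have := (hU.eq_iff (hU2 y r' h1 h0 h2)).1 rfl
          rw [this]; exact h2
        · obtain ⟨r, r', h1, h2, h3, h4, h5⟩ := opp_case H hS hy hn hD h0.1 h0.2
          have := (hU _ (hU2 r r' h1 h2 h3)).2.1 h4
          simp only at this
          linarith
        · obtain ⟨r, r', h1, h2, h3, h4, h5⟩ := opp_case H.swap
            (fun a ha => compat_swap.2 (hS _ (mem_swapS.1 ha))) (compat_swap.2 hy)
            (fun a ha => hn' _ (mem_swapS.1 ha)) hD' h0.2 h0.1
          have := (hU _ (hU2 r' r (compat_swap.1 h1) h3 h2)).1.1 h5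
          simp only at this
          linarith
      rcases lt_or_gt_of_ne (deriv_ne H hy hn) with h | h
      · have := main _ _ _ _ H.neg (by simpa using h) (fun r r' h1 h2 h3 => hU2 r r' h1 (by simpa using h2) (by simpa using h3))
        simp only [neg_eq_zero, Left.neg_pos_iff, Left.neg_neg_iff] at this
        exact ⟨this.1, this.2.2⟩
      · have := main _ _ _ _ H h hU2
        exact ⟨this.1, this.2.1⟩
    have hn' : ∀ a ∈ S, y' ≠ a.2 := fun a ha e => hn a ha ((hy.eq_iff ha).2 e)
    have k1 := key S f f' g g' y y' _ H hS hy hyy hn hTm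
    have k2 := key (swapS S) g g' f f' y' y (swapS (S ∪ T)) H.swap
      (fun a ha => compat_swap.2 (hS _ (mem_swapS.1 ha))) (compat_swap.2 hy) (compat_swap.2 hyy)
      (fun a ha => hn' _ (mem_swapS.1 ha))
      (fun r r' h1 h2 h3 => mem_swapS.2 (hTm r' r (compat_swap.1 h1) h3 h2))
    rcases lt_trichotomy (f y) 0 with h | h | h <;> rcases lt_trichotomy (g y') 0 with h' | h' | h'
    · rw [sign_neg h, sign_neg h']
    · exact absurd (k2.1 h') h.ne
    · exact absurd ⟨h', h⟩ k2.2
    · exact absurd (k1.1 h) h'.ne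
    · rw [h, h']
    · exact absurd (k1.1 h) h'.ne'
    · exact absurd ⟨h, h'⟩ k1.2
    · exact absurd (k2.1 h') h.ne'
    · rw [sign_pos h, sign_pos h']

open Filter Topology

section QE1
open Polynomial
variable {R : Type*} [CommRing R]

lemma exists_prem0 (g : R[X]) (hg : 1 ≤ g.natDegree) : ∀ (N : ℕ) (f : R[X]), f.natDegree ≤ N →
    ∃ (k : ℕ) (q r : R[X]),
    C g.leadingCoeff ^ k * f = q * g + r ∧ r.natDegree < g.natDegree := by
  intro N
  induction N with
  | zero => intro f hf; exact ⟨0, 0, f, by simp, by omega⟩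
  | succ N ih =>
    intro f hf
    by_cases hlt : f.natDegree < g.natDegree
    · exact ⟨0, 0, f, by simp, hlt⟩
    push Not at hlt
    set f1 : R[X] := C g.leadingCoeff * f - C f.leadingCoeff * X ^ (f.natDegree - g.natDegree) * g with hf1
    have hd1 : f1.natDegree ≤ f.natDegree := by
      refine (natDegree_sub_le _ _).trans (max_le ?_ ?_)
      · exact natDegree_C_mul_le _ _
      · rw [mul_assoc]
        refine (natDegree_C_mul_le _ _).trans (natDegree_mul_le.trans ?_)
        have := natDegree_X_pow_le (R := R) (f.natDegree - g.natDegree)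
        omega
    have hd2 : f1.coeff f.natDegree = 0 := by
      rw [hf1, coeff_sub, coeff_C_mul, mul_assoc, coeff_C_mul, coeff_X_pow_mul', if_pos (by omega),
        Nat.sub_sub_self hlt]
      simp only [leadingCoeff]
      ring
    have hd3 := natDegree_le_pred hd1 hd2
    obtain ⟨k, q, r, h1, h2⟩ := ih f1 (by omega)
    refine ⟨k + 1, q + C g.leadingCoeff ^ k * (C f.leadingCoeff * X ^ (f.natDegree - g.natDegree)), r, ?_, h2⟩
    have : C g.leadingCoeff ^ k * (C g.leadingCoeff * f) = C g.leadingCoeff ^ k * f1 +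
        C g.leadingCoeff ^ k * (C f.leadingCoeff * X ^ (f.natDegree - g.natDegree) * g) := by
      rw [hf1]; ring
    rw [pow_succ, mul_assoc, this, h1]; ring

lemma exists_prem (f g : R[X]) : ∃ r : R[X], 1 ≤ g.natDegree → r.natDegree < g.natDegree ∧
    ∃ (k : ℕ) (q : R[X]), C g.leadingCoeff ^ (2 * k) * f = q * g + r := by
  by_cases hg : 1 ≤ g.natDegree
  · obtain ⟨k, q, r, h1, h2⟩ := exists_prem0 g hg _ f le_rfl
    refine ⟨C g.leadingCoeff ^ k * r, fun _ => ⟨?_, k, C g.leadingCoeff ^ k * q, ?_⟩⟩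
    · rw [← C_pow]
      exact (natDegree_C_mul_le _ _).trans_lt h2
    · rw [two_mul, pow_add, mul_assoc, h1]; ring
  · exact ⟨0, fun h => absurd h hg⟩

noncomputable def prem (f g : R[X]) : R[X] := (exists_prem f g).choose

lemma prem_spec (f g : R[X]) (hg : 1 ≤ g.natDegree) : (prem f g).natDegree < g.natDegree ∧
    ∃ (k : ℕ) (q : R[X]), C g.leadingCoeff ^ (2 * k) * f = q * g + prem f g :=
  (exists_prem f g).choose_spec hg

def ClosedAt (d : ℕ) (F : Finset R[X]) : Prop :=
  ∀ f ∈ F, ∀ g ∈ F, 1 ≤ g.natDegree → d ≤ g.natDegree → g.natDegree ≤ f.natDegree →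
    derivative g ∈ F ∧ eraseLead g ∈ F ∧ prem f g ∈ F

lemma closedAt_step (d : ℕ) (F : Finset R[X]) (hF : ClosedAt (d + 1) F) :
    ∃ F', F ⊆ F' ∧ ClosedAt d F' := by
  classical
  let F1 : Finset R[X] := F.filter (fun g => 1 ≤ g.natDegree ∧ d = g.natDegree)
  let N : Finset R[X] := F1.image (fun g => derivative g) ∪ F1.image eraseLead ∪
    (F ×ˢ F1).image (fun p => prem p.1 p.2)
  have hN : ∀ x ∈ N, x.natDegree < d := by
    intro x hx
    simp only [N, F1, Finset.mem_union, Finset.mem_image, Finset.mem_filter, Finset.mem_product,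
      Prod.exists] at hx
    rcases hx with (⟨g, ⟨_, h1, h2⟩, rfl⟩ | ⟨g, ⟨_, h1, h2⟩, rfl⟩) | ⟨f, g, ⟨_, _, h1, h2⟩, rfl⟩
    · have := natDegree_derivative_lt (p := g) (by omega); omega
    · have := eraseLead_natDegree_le g; omega
    · have := (prem_spec f g h1).1; omega
  refine ⟨F ∪ N, Finset.subset_union_left, ?_⟩
  intro f hf g hg h1 h2 h3
  have hf' : f ∈ F := by
    rcases Finset.mem_union.1 hf with h | h
    · exact h
    · have := hN f h; omega
  have hg' : g ∈ F := by
    rcases Finset.mem_union.1 hg with h | h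
    · exact h
    · have := hN g h; omega
  rcases Nat.lt_or_eq_of_le h2 with h4 | h4
  · obtain ⟨a, b, c⟩ := hF f hf' g hg' h1 h4 h3
    exact ⟨Finset.mem_union_left _ a, Finset.mem_union_left _ b, Finset.mem_union_left _ c⟩
  · have hg1 : g ∈ F1 := Finset.mem_filter.2 ⟨hg', h1, h4⟩
    refine ⟨Finset.mem_union_right _ ?_, Finset.mem_union_right _ ?_, Finset.mem_union_right _ ?_⟩
    · exact Finset.mem_union_left _ (Finset.mem_union_left _ (Finset.mem_image_of_mem _ hg1))
    · exact Finset.mem_union_left _ (Finset.mem_union_right _ (Finset.mem_image_of_mem _ hg1))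
    · exact Finset.mem_union_right _ (Finset.mem_image.2 ⟨(f, g), Finset.mem_product.2 ⟨hf', hg1⟩, rfl⟩)

lemma exists_closed (F : Finset R[X]) : ∃ F', F ⊆ F' ∧ ClosedAt 0 F' := by
  have key : ∀ d (F : Finset R[X]), ClosedAt d F → ∃ F', F ⊆ F' ∧ ClosedAt 0 F' := by
    intro d
    induction d with
    | zero => exact fun F h => ⟨F, Finset.Subset.refl _, h⟩
    | succ d ih =>
      intro F h
      obtain ⟨F1, h1, h2⟩ := closedAt_step d F h
      obtain ⟨F2, h3, h4⟩ := ih F1 h2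
      exact ⟨F2, h1.trans h3, h4⟩
  refine key (F.sup natDegree + 1) F ?_
  intro f _ g hg _ h
  have := Finset.le_sup (f := natDegree) hg
  omega

lemma poly_GF (p : ℝ[X]) (hp : 0 < p.natDegree) : GF (fun x => p.eval x) (fun x => p.derivative.eval x) := by
  have hd : p.derivative ≠ 0 := by
    intro h
    have := natDegree_eq_zero_of_derivative_eq_zero h
    omega
  refine ⟨fun x => p.hasDerivAt x, p.abs_tendsto_atTop (natDegree_pos_iff_degree_pos.1 hp), ?_, ?_⟩
  · have h1 : 0 < (p.comp (-X)).degree := by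
      rw [← natDegree_pos_iff_degree_pos, natDegree_comp]; simpa using hp
    have := ((p.comp (-X)).abs_tendsto_atTop h1).comp tendsto_neg_atBot_atTop
    simpa [Function.comp_def] using this
  · intro a b hab
    by_contra hcon
    push Not at hcon
    apply hd
    apply eq_zero_of_infinite_isRoot
    exact (Set.Ioo_infinite hab).mono (fun x hx => hcon x hx.1 hx.2)

lemma eval_map_eraseLead (θ : R →+* ℝ) (f : R[X]) (h : θ f.leadingCoeff = 0) (y : ℝ) :
    ((eraseLead f).map θ).eval y = (f.map θ).eval y := by
  have := congrArg (fun t => (t.map θ).eval y) (eraseLead_add_C_mul_X_pow f)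
  simp only [Polynomial.map_add, Polynomial.map_mul, map_C, h] at this
  simpa using this

theorem diag (F : Finset R[X]) : ClosedAt 0 F → ∀ θ θ' : R →+* ℝ,
    (∀ f ∈ F, SignType.sign (θ f.leadingCoeff) = SignType.sign (θ' f.leadingCoeff)) →
    ∃ S, PIso S ∧ (∀ a ∈ S, ∃ g ∈ F, 1 ≤ g.natDegree ∧ θ g.leadingCoeff ≠ 0 ∧
      (g.map θ).eval a.1 = 0 ∧ (g.map θ').eval a.2 = 0) ∧
      ∀ y y', Compat S y y' → ∀ f ∈ F,
        SignType.sign ((f.map θ).eval y) = SignType.sign ((f.map θ').eval y') := by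
  classical
  induction F using Finset.induction_on_max_value (fun f : R[X] => f.natDegree) with
  | empty => exact fun _ θ θ' _ => ⟨∅, by simp [PIso], by simp, by simp⟩
  | insert a s ha hmax ih =>
    intro hcl θ θ' hsg
    have hdrop : ∀ x ∈ insert a s, x.natDegree < a.natDegree → x ∈ s := by
      intro x hx hlt
      rcases Finset.mem_insert.1 hx with h | h
      · rw [h] at hlt; omega
      · exact h
    have hcs : ClosedAt 0 s := by
      intro f hf g hg h1 h2 h3
      obtain ⟨p1, p2, p3⟩ := hcl f (Finset.mem_insert_of_mem hf) g (Finset.mem_insert_of_mem hg) h1 h2 h3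
      have hga := hmax g hg
      refine ⟨hdrop _ p1 ?_, hdrop _ p2 ?_, hdrop _ p3 ?_⟩
      · have := natDegree_derivative_lt (p := g) (by omega); omega
      · have := eraseLead_natDegree_le g; omega
      · have := (prem_spec f g h1).1; omega
    obtain ⟨S, hS, hroot, hm⟩ := ih hcs θ θ' (fun f hf => hsg f (Finset.mem_insert_of_mem hf))
    have hsa := hsg a (Finset.mem_insert_self _ _)
    have fin1 : (∀ y y', Compat S y y' → 
        SignType.sign ((a.map θ).eval y) = SignType.sign ((a.map θ').eval y')) → 
        ∃ S, PIso S ∧ (∀ b ∈ S, ∃ g ∈ insert a s, 1 ≤ g.natDegree ∧ θ g.leadingCoeff ≠ 0 ∧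
      (g.map θ).eval b.1 = 0 ∧ (g.map θ').eval b.2 = 0) ∧
      ∀ y y', Compat S y y' → ∀ f ∈ insert a s,
        SignType.sign ((f.map θ).eval y) = SignType.sign ((f.map θ').eval y') := by
      intro h
      refine ⟨S, hS, fun b hb => ?_, fun y y' hy f hf => ?_⟩
      · obtain ⟨g, hg, h⟩ := hroot b hb
        exact ⟨g, Finset.mem_insert_of_mem hg, h⟩
      · rcases Finset.mem_insert.1 hf with rfl | hf
        · exact h y y' hy
        · exact hm y y' hy f hf
    rcases Nat.eq_zero_or_pos a.natDegree with h0 | hpos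
    · apply fin1
      intro y y' _
      rw [eq_C_of_natDegree_eq_zero h0] at hsa ⊢
      simpa using hsa
    obtain ⟨p1, p2, p3⟩ := hcl a (Finset.mem_insert_self _ _) a (Finset.mem_insert_self _ _) hpos
      (Nat.zero_le _) le_rfl
    have hder : derivative a ∈ s := hdrop _ p1 (natDegree_derivative_lt (by omega))
    have her : eraseLead a ∈ s := hdrop _ p2 (by have := eraseLead_natDegree_le a; omega)
    by_cases hlc : θ a.leadingCoeff = 0
    · apply fin1
      intro y y' hy
      have hlc' := sign_zero_of hsa hlc
      rw [← eval_map_eraseLead θ a hlc, ← eval_map_eraseLead θ' a hlc']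
      exact hm y y' hy _ her
    have hlc' : θ' a.leadingCoeff ≠ 0 := fun h => hlc (sign_zero_of hsa.symm h)
    have hd1 : 0 < (a.map θ).natDegree := by rwa [natDegree_map_of_leadingCoeff_ne_zero _ hlc]
    have hd2 : 0 < (a.map θ').natDegree := by rwa [natDegree_map_of_leadingCoeff_ne_zero _ hlc']
    have H : EH S (fun x => (a.map θ).eval x) (fun x => (a.map θ).derivative.eval x)
        (fun x => (a.map θ').eval x) (fun x => (a.map θ').derivative.eval x) := by
      refine ⟨poly_GF _ hd1, poly_GF _ hd2, ?_, ?_⟩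
      · intro y y' hy
        simp only [derivative_map]
        exact hm y y' hy _ hder
      · intro b hb
        obtain ⟨g, hg, h1, h2, h3, h4⟩ := hroot b hb
        have h2' : θ' g.leadingCoeff ≠ 0 := fun h =>
          h2 (sign_zero_of (hsg g (Finset.mem_insert_of_mem hg)).symm h)
        obtain ⟨_, _, hp⟩ := hcl a (Finset.mem_insert_self _ _) g (Finset.mem_insert_of_mem hg) h1
          (Nat.zero_le _) (hmax g hg)
        obtain ⟨hdeg, k, q, hk⟩ := prem_spec a g h1
        have hp' := hdrop _ hp (by have := hmax g hg; omega)
        have e := hm _ _ (hS b hb) _ hp'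
        have gen : ∀ (η : R →+* ℝ) (x : ℝ), η g.leadingCoeff ≠ 0 → (g.map η).eval x = 0 →
            SignType.sign (((prem a g).map η).eval x) = SignType.sign ((a.map η).eval x) := by
          intro η x hne hz
          have := congrArg (fun t => (t.map η).eval x) hk
          simp only [Polynomial.map_mul, Polynomial.map_add, Polynomial.map_pow, map_C, eval_mul,
            eval_add, eval_pow, eval_C, hz, mul_zero, zero_add] at this
          rw [← this, sign_mul, sign_pos (by rw [pow_mul]; positivity), one_mul]
        rw [gen θ _ h2 h3, gen θ' _ h2' h4] at e
        exact e
    obtain ⟨S2, hsub, hS2, hr2, hm2⟩ := extend_step H hS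
      (by
        apply Set.Finite.subset (a.map θ).roots.toFinset.finite_toSet
        intro x hx
        have : a.map θ ≠ 0 := by rintro h; rw [h] at hd1; simp at hd1
        simpa [this] using hx)
      (by
        apply Set.Finite.subset (a.map θ').roots.toFinset.finite_toSet
        intro x hx
        have : a.map θ' ≠ 0 := by rintro h; rw [h] at hd2; simp at hd2
        simpa [this] using hx)
    refine ⟨S2, hS2, fun b hb => ?_, fun y y' hy f hf => ?_⟩
    · rcases hr2 b hb with h | h
      · obtain ⟨g, hg, h⟩ := hroot b h
        exact ⟨g, Finset.mem_insert_of_mem hg, h⟩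
      · exact ⟨a, Finset.mem_insert_self _ _, hpos, hlc, h⟩
    · rcases Finset.mem_insert.1 hf with rfl | hf
      · exact hm2 y y' hy
      · exact hm y y' (fun b hb => hy b (hsub hb)) f hf

theorem elim1 (F : Finset R[X]) : ∃ G : Finset R, ∀ θ θ' : R →+* ℝ,
    (∀ g ∈ G, SignType.sign (θ g) = SignType.sign (θ' g)) → ∀ y : ℝ, ∃ y' : ℝ, ∀ f ∈ F,
      SignType.sign ((f.map θ).eval y) = SignType.sign ((f.map θ').eval y') := by
  classical
  obtain ⟨F', hsub, hcl⟩ := exists_closed F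
  refine ⟨F'.image leadingCoeff, fun θ θ' h y => ?_⟩
  obtain ⟨S, hS, _, hm⟩ := diag F' hcl θ θ' (fun f hf => h _ (Finset.mem_image_of_mem _ hf))
  obtain ⟨y', hy'⟩ := compat_exists hS y
  exact ⟨y', fun f hf => hm y y' hy' f (hsub hf)⟩

end QE1

section QEN
open MvPolynomial

def ElimProp (ι : Type) (R : Type) [CommRing R] : Prop :=
  ∀ F : Finset (MvPolynomial ι R), ∃ G : Finset R, ∀ θ θ' : R →+* ℝ,
    (∀ g ∈ G, SignType.sign (θ g) = SignType.sign (θ' g)) → ∀ y : ι → ℝ, ∃ y' : ι → ℝ, ∀ f ∈ F,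
      SignType.sign (eval₂ θ y f) = SignType.sign (eval₂ θ' y' f)

theorem elimN (ι : Type) [Finite ι] : ∀ (R : Type) [CommRing R], ElimProp ι R := by
  classical
  induction ι using Finite.induction_empty_option with
  | of_equiv e ih =>
    intro R _ F
    obtain ⟨G, hG⟩ := ih R (F.image (rename e.symm))
    refine ⟨G, fun θ θ' h y => ?_⟩
    obtain ⟨y', hy'⟩ := hG θ θ' h (y ∘ e)
    refine ⟨y' ∘ e.symm, fun f hf => ?_⟩
    have := hy' _ (Finset.mem_image_of_mem _ hf)
    rw [eval₂_rename, eval₂_rename] at this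
    simpa [Function.comp_assoc] using this
  | h_empty =>
    intro R _ F
    refine ⟨F.image (constantCoeff), fun θ θ' h y => ⟨y, fun f hf => ?_⟩⟩
    have := h _ (Finset.mem_image_of_mem _ hf)
    obtain ⟨r, rfl⟩ := C_surjective PEmpty f
    simpa using this
  | h_option ih =>
    rename_i α _
    intro R _ F
    obtain ⟨G1, hG1⟩ := elim1 (F.image (optionEquivLeft R α))
    obtain ⟨G2, hG2⟩ := ih R G1
    refine ⟨G2, fun θ θ' h y => ?_⟩
    obtain ⟨z', hz'⟩ := hG2 θ θ' h (fun a => y (some a))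
    obtain ⟨y0', hy0'⟩ := hG1 (eval₂Hom θ (fun a => y (some a))) (eval₂Hom θ' z') hz' (y none)
    refine ⟨fun o => o.elim y0' z', fun f hf => ?_⟩
    have := hy0' _ (Finset.mem_image_of_mem _ hf)
    have gen : ∀ (η : R →+* ℝ) (w : α → ℝ) (w0 : ℝ) (f : MvPolynomial (Option α) R),
        (((optionEquivLeft R α) f).map (eval₂Hom η w)).eval w0 =
          eval₂ η (fun o => Option.elim o w0 w) f := by
      intro η w w0 f
      induction f using MvPolynomial.induction_on with
      | C a => simp
      | add p q hp hq => rw [map_add, Polynomial.map_add, Polynomial.eval_add, hp, hq, eval₂_add]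
      | mul_X p n hp =>
        rw [map_mul, Polynomial.map_mul, Polynomial.eval_mul, hp, eval₂_mul, eval₂_X]
        cases n <;> simp
    rw [gen, gen] at this
    convert this using 4
    rename_i o
    cases o <;> rfl
end QEN

open Filter Topology
noncomputable section

lemma dotR_add {n : ℕ} (w x y : Fin n → ℝ) : dotR w (x + y) = dotR w x + dotR w y := by
  simp [dotR, mul_add, Finset.sum_add_distrib]
lemma dotR_sub {n : ℕ} (w x y : Fin n → ℝ) : dotR w (x - y) = dotR w x - dotR w y := by
  simp [dotR, mul_sub, Finset.sum_sub_distrib]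
lemma dotR_neg {n : ℕ} (w x : Fin n → ℝ) : dotR w (-x) = - dotR w x := by
  simp [dotR]
lemma dotR_smul {n : ℕ} (w : Fin n → ℝ) (t : ℝ) (x : Fin n → ℝ) : dotR w (t • x) = t * dotR w x := by
  simp [dotR, Finset.mul_sum, mul_left_comm]
lemma dotR_zero {n : ℕ} (w : Fin n → ℝ) : dotR w 0 = 0 := by simp [dotR]
lemma dotR_comm {n : ℕ} (w x : Fin n → ℝ) : dotR w x = dotR x w := by
  simp [dotR, mul_comm]
lemma dotR_sum {n : ℕ} {ι : Type*} (w : Fin n → ℝ) (s : Finset ι) (f : ι → Fin n → ℝ) :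
    dotR w (∑ i ∈ s, f i) = ∑ i ∈ s, dotR w (f i) := by
  classical
  induction s using Finset.induction_on with
  | empty => simp [dotR_zero]
  | insert a s ha ih => rw [Finset.sum_insert ha, dotR_add, ih, Finset.sum_insert ha]
lemma continuous_dotR {n : ℕ} (w : Fin n → ℝ) : Continuous (fun x => dotR w x) := by
  unfold dotR; fun_prop

def qv {n : ℕ} (h : Fin n → ℚ) : Fin n → ℝ := fun i => (h i : ℝ)

lemma qv_neg {n : ℕ} (h : Fin n → ℚ) : qv (-h) = - qv h := by ext i; simp [qv]

/-- Pairing of a rational vector with a real one. -/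
def pr {n : ℕ} (h : Fin n → ℚ) (c : Fin n → ℝ) : ℝ := dotR (qv h) c

lemma pr_neg {n : ℕ} (h : Fin n → ℚ) (c : Fin n → ℝ) : pr (-h) c = - pr h c := by
  simp [pr, qv, dotR]
lemma pr_subl {n : ℕ} (h k : Fin n → ℚ) (c : Fin n → ℝ) : pr (h - k) c = pr h c - pr k c := by
  simp [pr, qv, dotR, sub_mul, Finset.sum_sub_distrib]

def Deep {n : ℕ} (H : Finset (Fin n → ℚ)) (u : Fin n → ℝ) (R : ℝ) (c : Fin n → ℝ) : Prop :=
  ∀ h ∈ H, (pr h u = 0 → pr h c = 0) ∧ (0 < pr h u → R ≤ pr h c)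

lemma Deep.mono {n : ℕ} {H : Finset (Fin n → ℚ)} {u : Fin n → ℝ} {R R' : ℝ} {c : Fin n → ℝ}
    (h : Deep H u R' c) (hR : R ≤ R') : Deep H u R c :=
  fun k hk => ⟨(h k hk).1, fun hp => hR.trans ((h k hk).2 hp)⟩

lemma sign_add_small {b d : ℝ} (h : |d| < |b|) : SignType.sign (b + d) = SignType.sign b := by
  rcases lt_trichotomy b 0 with hb | hb | hb
  · rw [abs_of_neg hb] at h
    have := le_abs_self d
    rw [sign_neg hb, sign_neg (by linarith)]
  · subst hb; simp at h; exact absurd h (not_lt.2 (abs_nonneg d))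
  · rw [abs_of_pos hb] at h
    have := neg_abs_le d
    rw [sign_pos hb, sign_pos (by linarith)]

lemma sign_stab {n : ℕ} (H : Finset (Fin n → ℚ)) (u : Fin n → ℝ) {ι : Type} (a : ι → ℝ)
    (e : ι → Fin n → ℚ) (A : Finset ι) : (∀ i ∈ A, ∀ j ∈ A, e i - e j ∈ H) →
    ∃ (R : ℝ) (s : SignType), ∀ c, Deep H u R c →
      SignType.sign (∑ i ∈ A, a i * Real.exp (-(pr (e i) c))) = s := by
  classical
  induction A using Finset.strongInduction with
  | H A ih =>
    intro hH
    rcases A.eq_empty_or_nonempty with rfl | hne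
    · exact ⟨0, 0, by simp⟩
    obtain ⟨i0, hi0, hmin⟩ := Finset.exists_min_image A (fun i => pr (e i) u) hne
    set B := A.filter (fun i => pr (e i) u = pr (e i0) u) with hB
    set D := A.filter (fun i => ¬ pr (e i) u = pr (e i0) u) with hD
    have hsplit : ∀ f : ι → ℝ, ∑ i ∈ A, f i = ∑ i ∈ B, f i + ∑ i ∈ D, f i := fun f =>
      (Finset.sum_filter_add_sum_filter_not A _ f).symm
    have hBc : ∀ R c, Deep H u R c → ∑ i ∈ B, a i * Real.exp (-(pr (e i) c)) =
        Real.exp (-(pr (e i0) c)) * ∑ i ∈ B, a i := by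
      intro R c hc
      rw [Finset.mul_sum]
      refine Finset.sum_congr rfl (fun i hi => ?_)
      rw [hB, Finset.mem_filter] at hi
      have := (hc _ (hH i hi.1 i0 hi0)).1 (by rw [pr_subl, hi.2, sub_self])
      rw [pr_subl, sub_eq_zero] at this
      rw [this, mul_comm]
    by_cases hb : ∑ i ∈ B, a i = 0
    · obtain ⟨R, s, h⟩ := ih D (by
        refine ⟨Finset.filter_subset _ _, fun hsub => ?_⟩
        have := hsub hi0
        simp [hD] at this) (fun i hi j hj => hH i (Finset.mem_filter.1 hi).1 j (Finset.mem_filter.1 hj).1)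
      refine ⟨R, s, fun c hc => ?_⟩
      rw [hsplit, hBc R c hc, hb, mul_zero, zero_add]
      exact h c hc
    · set b := ∑ i ∈ B, a i
      set M := ∑ i ∈ D, |a i|
      have hlim : Tendsto (fun R : ℝ => M * Real.exp (-R)) atTop (𝓝 (M * 0)) :=
        (Real.tendsto_exp_neg_atTop_nhds_zero).const_mul M
      rw [mul_zero] at hlim
      obtain ⟨R, hR⟩ := (hlim.eventually (eventually_lt_nhds (abs_pos.2 hb))).exists
      refine ⟨R, SignType.sign b, fun c hc => ?_⟩
      have e2 : ∑ i ∈ D, a i * Real.exp (-(pr (e i) c)) = Real.exp (-(pr (e i0) c)) *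
          ∑ i ∈ D, a i * Real.exp (-(pr (e i - e i0) c)) := by
        rw [Finset.mul_sum]
        refine Finset.sum_congr rfl (fun i hi => ?_)
        rw [mul_left_comm, ← Real.exp_add, pr_subl]
        congr 2; ring
      rw [hsplit, hBc R c hc, e2, ← mul_add, sign_mul, sign_pos (Real.exp_pos _), one_mul]
      apply sign_add_small
      refine lt_of_le_of_lt ?_ hR
      refine (Finset.abs_sum_le_sum_abs _ _).trans ?_
      rw [Finset.sum_mul]
      refine Finset.sum_le_sum (fun i hi => ?_)
      rw [abs_mul, Real.abs_exp]
      refine mul_le_mul_of_nonneg_left (Real.exp_le_exp.2 ?_) (abs_nonneg _)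
      rw [hD, Finset.mem_filter] at hi
      have := (hc _ (hH i hi.1 i0 hi0)).2 (by
        rw [pr_subl]; exact sub_pos.2 (lt_of_le_of_ne (hmin i hi.1) (Ne.symm hi.2)))
      linarith

def Phi {n m : ℕ} (V : Set ((Fin n → ℝ) × (Fin m → ℝ))) (y : Fin n → ℝ) (z0 : Fin m → ℝ) (ε δ : ℝ)
    (c : Fin n → ℝ) : Prop :=
  ∃ x ∈ V, (∀ i, |x.1 i * Real.exp (c i) - y i| < ε) ∧ ∀ j, |δ * (x.2 j - z0 j)| < ε

section
open MvPolynomial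

abbrev PP (n m : ℕ) : Type := (Fin n → ℝ) × (Fin m → ℝ) × ℝ × ℝ
abbrev R0 (n m : ℕ) : Type := MvPolynomial (Fin n) (PP n m → ℝ)

def thet {n m : ℕ} (s : Fin n → ℝ) (p : PP n m) : R0 n m →+* ℝ :=
  eval₂Hom (Pi.evalRingHom (fun _ : PP n m => ℝ) p) s

lemma thet_C {n m : ℕ} (s : Fin n → ℝ) (p : PP n m) (f : PP n m → ℝ) : thet s p (C f) = f p := by
  simp [thet]

lemma thet_X {n m : ℕ} (s : Fin n → ℝ) (p : PP n m) (i : Fin n) : thet s p (X i) = s i := by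
  simp [thet]

def Tq {n m : ℕ} (q : MvPolynomial (Fin n ⊕ Fin m) ℝ) : MvPolynomial (Fin n ⊕ Fin m) (R0 n m) :=
  eval₂ (C.comp (C.comp (Pi.constRingHom (PP n m) ℝ)))
    (Sum.elim (fun i => C (X i) * X (Sum.inl i)) (fun j => X (Sum.inr j))) q

lemma eval_Tq {n m : ℕ} (q : MvPolynomial (Fin n ⊕ Fin m) ℝ) (s : Fin n → ℝ) (p : PP n m)
    (y : Fin n ⊕ Fin m → ℝ) : eval₂ (thet s p) y (Tq q) =
      eval (Sum.elim (fun i => s i * y (Sum.inl i)) (fun j => y (Sum.inr j))) q := by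
  induction q using MvPolynomial.induction_on with
  | C a => simp [Tq, thet_C]
  | add p q hp hq => 
    simp only [Tq] at hp hq ⊢
    rw [eval₂_add, eval₂_add, hp, hq, map_add]
  | mul_X p k hp =>
    simp only [Tq] at hp ⊢
    rw [eval₂_mul, eval₂_mul, hp, map_mul, eval₂_X, eval_X]
    congr 1
    cases k <;> simp [thet_X]

def epsP {n m : ℕ} : MvPolynomial (Fin n ⊕ Fin m) (R0 n m) := C (C (fun p => p.2.2.1))
def delP {n m : ℕ} : MvPolynomial (Fin n ⊕ Fin m) (R0 n m) := C (C (fun p => p.2.2.2))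
def yP {n m : ℕ} (i : Fin n) : MvPolynomial (Fin n ⊕ Fin m) (R0 n m) := C (C (fun p => p.1 i))
def zP {n m : ℕ} (i : Fin m) : MvPolynomial (Fin n ⊕ Fin m) (R0 n m) := C (C (fun p => p.2.1 i))

lemma nonneg_of_sign {a b : ℝ} (h : SignType.sign a = SignType.sign b) (ha : 0 ≤ a) : 0 ≤ b := by
  by_contra hc
  push Not at hc
  have := sign_neg_of h.symm hc
  linarith

theorem key {n m : ℕ} {V : Set ((Fin n → ℝ) × (Fin m → ℝ))}
    (hV : IsClosedSemialgebraicInOrthant n m V) :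
    ∃ H : Finset (Fin n → ℚ), (∀ h ∈ H, -h ∈ H) ∧ (∀ i, Pi.single i 1 ∈ H) ∧
      ∀ u y z0 ε δ, ∃ R, ∀ c c', Deep H u R c → Deep H u R c' → Phi V y z0 ε δ c →
        Phi V y z0 ε δ c' := by
  classical
  obtain ⟨W, ⟨N, P, hW⟩, hVW⟩ := hV
  let F : Finset (MvPolynomial (Fin n ⊕ Fin m) (R0 n m)) :=
    (Finset.univ.biUnion P).image Tq ∪ (Finset.univ.image (fun i => X (Sum.inl i)) ∪
    (Finset.univ.image (fun i => epsP - (X (Sum.inl i) - yP i)) ∪ 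
    (Finset.univ.image (fun i => epsP + (X (Sum.inl i) - yP i)) ∪
    (Finset.univ.image (fun j => epsP - delP * (X (Sum.inr j) - zP j)) ∪
    (Finset.univ.image (fun j => epsP + delP * (X (Sum.inr j) - zP j)))))))
  obtain ⟨G, hG⟩ := elimN (Fin n ⊕ Fin m) (R0 n m) F
  let ex : (Fin n →₀ ℕ) → Fin n → ℚ := fun α i => (α i : ℚ)
  let H0 : Finset (Fin n → ℚ) := G.biUnion (fun g => (g.support ×ˢ g.support).image
    (fun p => ex p.1 - ex p.2)) ∪ Finset.univ.image (fun i => Pi.single i 1)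
  refine ⟨H0 ∪ H0.image (fun h => -h), ?_, ?_, ?_⟩
  · intro h hh
    rcases Finset.mem_union.1 hh with hh | hh
    · exact Finset.mem_union_right _ (Finset.mem_image_of_mem _ hh)
    · obtain ⟨k, hk, rfl⟩ := Finset.mem_image.1 hh
      rw [neg_neg]; exact Finset.mem_union_left _ hk
  · intro i
    exact Finset.mem_union_left _ (Finset.mem_union_right _
      (Finset.mem_image_of_mem (fun i => Pi.single i 1) (Finset.mem_univ i)))
  intro u y z0 ε δ
  set H := H0 ∪ H0.image (fun h => -h) with hH
  let p : PP n m := (y, z0, ε, δ)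
  have hst : ∀ g : R0 n m, ∃ R : ℝ, g ∈ G → ∃ s : SignType, ∀ c, Deep H u R c →
      SignType.sign (thet (fun i => Real.exp (-(c i))) p g) = s := by
    intro g
    by_cases hg : g ∈ G
    swap
    · exact ⟨0, fun h => absurd h hg⟩
    obtain ⟨R, s, h⟩ := sign_stab H u (fun α => (g.coeff α) p) ex g.support (by
      intro i hi j hj
      refine Finset.mem_union_left _ (Finset.mem_union_left _ (Finset.mem_biUnion.2 ⟨g, hg, ?_⟩))
      exact Finset.mem_image.2 ⟨(i, j), Finset.mem_product.2 ⟨hi, hj⟩, rfl⟩)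
    refine ⟨R, fun _ => ⟨s, fun c hc => ?_⟩⟩
    rw [← h c hc]
    congr 1
    simp only [thet, coe_eval₂Hom, eval₂_eq']
    refine Finset.sum_congr rfl (fun α hα => ?_)
    congr 1
    simp only [← Real.exp_nat_mul, ← Real.exp_sum]
    congr 1
    simp only [pr, dotR, qv, ex, ← Finset.sum_neg_distrib]
    refine Finset.sum_congr rfl (fun i _ => ?_)
    push_cast; ring
  choose Rg hRg using hst
  refine ⟨∑ g ∈ G, |Rg g|, fun c c' hc hc' hphi => ?_⟩
  have hle : ∀ g ∈ G, Rg g ≤ ∑ g ∈ G, |Rg g| := fun g hg => (le_abs_self _).trans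
    (Finset.single_le_sum (f := fun g => |Rg g|) (fun _ _ => abs_nonneg _) hg)
  obtain ⟨x, hx, hx1, hx2⟩ := hphi
  obtain ⟨y', hy'⟩ := hG (thet (fun i => Real.exp (-(c i))) p) (thet (fun i => Real.exp (-(c' i))) p)
    (by
      intro g hg
      obtain ⟨s, hs⟩ := hRg g hg
      rw [hs c (hc.mono (hle g hg)), hs c' (hc'.mono (hle g hg))])
    (Sum.elim (fun i => x.1 i * Real.exp (c i)) x.2)
  have m1 : ∀ j, ∀ q ∈ P j, SignType.sign (eval (Sum.elim x.1 x.2) q) = SignType.sign (eval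
      (Sum.elim (fun i => Real.exp (-(c' i)) * y' (Sum.inl i)) (fun j => y' (Sum.inr j))) q) := by
    intro j q hq
    have := hy' (Tq q) (Finset.mem_union_left _ (Finset.mem_image_of_mem _
      (Finset.mem_biUnion.2 ⟨j, Finset.mem_univ _, hq⟩)))
    rw [eval_Tq, eval_Tq] at this
    rw [← this]
    congr 4
    funext i
    simp only [Sum.elim_inl]
    rw [mul_left_comm, ← Real.exp_add]; simp
  have m2 : ∀ i, SignType.sign (x.1 i * Real.exp (c i)) = SignType.sign (y' (Sum.inl i)) := by
    intro i
    have := hy' (X (Sum.inl i)) (by simp [F])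
    simpa using this
  have m3 : ∀ i, SignType.sign (ε - (x.1 i * Real.exp (c i) - y i)) =
      SignType.sign (ε - (y' (Sum.inl i) - y i)) := by
    intro i
    have := hy' (epsP - (X (Sum.inl i) - yP i)) (by simp [F])
    simpa [epsP, yP, eval₂_sub, thet_C, p] using this
  have m4 : ∀ i, SignType.sign (ε + (x.1 i * Real.exp (c i) - y i)) =
      SignType.sign (ε + (y' (Sum.inl i) - y i)) := by
    intro i
    have := hy' (epsP + (X (Sum.inl i) - yP i)) (by simp [F])
    simpa [epsP, yP, eval₂_sub, thet_C, p] using this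
  have m5 : ∀ j, SignType.sign (ε - δ * (x.2 j - z0 j)) =
      SignType.sign (ε - δ * (y' (Sum.inr j) - z0 j)) := by
    intro j
    have := hy' (epsP - delP * (X (Sum.inr j) - zP j)) (by simp [F])
    simpa [epsP, zP, delP, eval₂_sub, thet_C, p] using this
  have m6 : ∀ j, SignType.sign (ε + δ * (x.2 j - z0 j)) =
      SignType.sign (ε + δ * (y' (Sum.inr j) - z0 j)) := by
    intro j
    have := hy' (epsP + delP * (X (Sum.inr j) - zP j)) (by simp [F])
    simpa [epsP, zP, delP, eval₂_sub, thet_C, p] using this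
  rw [hVW] at hx
  obtain ⟨hxp, hxW⟩ := hx
  rw [hW] at hxW
  obtain ⟨j, hj⟩ := Set.mem_iUnion.1 hxW
  refine ⟨(fun i => Real.exp (-(c' i)) * y' (Sum.inl i), fun j => y' (Sum.inr j)), ?_, ?_, ?_⟩
  · rw [hVW]
    constructor
    · intro i
      exact mul_pos (Real.exp_pos _) (sign_pos_of (m2 i) (mul_pos (hxp i) (Real.exp_pos _)))
    · rw [hW]
      refine Set.mem_iUnion.2 ⟨j, fun q hq => ?_⟩
      exact nonneg_of_sign (m1 j q hq) (hj q hq)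
  · intro i
    have e : Real.exp (-(c' i)) * y' (Sum.inl i) * Real.exp (c' i) = y' (Sum.inl i) := by
      rw [mul_right_comm, ← Real.exp_add]; simp
    simp only [e]
    have h1 := abs_lt.1 (hx1 i)
    have h2 := sign_pos_of (m3 i) (by linarith)
    have h3 := sign_pos_of (m4 i) (by linarith)
    exact abs_lt.2 ⟨by linarith, by linarith⟩
  · intro j
    have h1 := abs_lt.1 (hx2 j)
    have h2 := sign_pos_of (m5 j) (by linarith)
    have h3 := sign_pos_of (m6 j) (by linarith)
    exact abs_lt.2 ⟨by linarith, by linarith⟩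
end
end

open Filter Topology
noncomputable section

lemma pr_add {n : ℕ} (h : Fin n → ℚ) (c d : Fin n → ℝ) : pr h (c + d) = pr h c + pr h d := dotR_add _ _ _
lemma pr_sub {n : ℕ} (h : Fin n → ℚ) (c d : Fin n → ℝ) : pr h (c - d) = pr h c - pr h d := dotR_sub _ _ _
lemma pr_smul {n : ℕ} (h : Fin n → ℚ) (t : ℝ) (d : Fin n → ℝ) : pr h (t • d) = t * pr h d := dotR_smul _ _ _
lemma pr_zero {n : ℕ} (h : Fin n → ℚ) : pr h 0 = 0 := dotR_zero _
lemma pr_negr {n : ℕ} (h : Fin n → ℚ) (c : Fin n → ℝ) : pr h (-c) = - pr h c := dotR_neg _ _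
lemma pr_sum {n : ℕ} {ι : Type*} (h : Fin n → ℚ) (s : Finset ι) (f : ι → Fin n → ℝ) :
    pr h (∑ i ∈ s, f i) = ∑ i ∈ s, pr h (f i) := dotR_sum _ _ _
lemma pr_single {n : ℕ} (i : Fin n) (c : Fin n → ℝ) : pr (Pi.single i 1) c = c i := by
  rw [pr, dotR, Finset.sum_eq_single i]
  · simp [qv]
  · intro j _ hj; simp [qv, hj]
  · simp

def pc {n : ℕ} (L : Finset (Fin n → ℚ)) : Set (Fin n → ℝ) := {c | ∀ h ∈ L, 0 ≤ pr h c}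

def cell {n : ℕ} (H : Finset (Fin n → ℚ)) (u : Fin n → ℝ) : Set (Fin n → ℝ) :=
  {c | ∀ h ∈ H, 0 ≤ pr h u → 0 ≤ pr h c}

lemma cell_eq_pc {n : ℕ} (H : Finset (Fin n → ℚ)) (u : Fin n → ℝ) :
    ∃ L ∈ H.powerset, cell H u = pc L := by
  classical
  refine ⟨H.filter (fun h => 0 ≤ pr h u), by simp, ?_⟩
  ext c
  simp [cell, pc]

section cells
variable {n : ℕ} {H : Finset (Fin n → ℚ)} {u c d : Fin n → ℝ}

lemma cell_self : u ∈ cell H u := fun _ _ h => h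
lemma cell_zero : (0 : Fin n → ℝ) ∈ cell H u := fun _ _ _ => by rw [pr_zero]
lemma cell_add (hc : c ∈ cell H u) (hd : d ∈ cell H u) : c + d ∈ cell H u := fun h hh hu => by
  rw [pr_add]; exact add_nonneg (hc h hh hu) (hd h hh hu)
lemma cell_smul {t : ℝ} (ht : 0 ≤ t) (hc : c ∈ cell H u) : t • c ∈ cell H u := fun h hh hu => by
  rw [pr_smul]; exact mul_nonneg ht (hc h hh hu)
lemma cell_trans (hc : c ∈ cell H u) : cell H c ⊆ cell H u := fun _ hd h hh hu =>
  hd h hh (hc h hh hu)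
lemma cell_nonpos (Hs : ∀ h ∈ H, -h ∈ H) (hc : c ∈ cell H u) {h : Fin n → ℚ} (hh : h ∈ H)
    (hu : pr h u ≤ 0) : pr h c ≤ 0 := by
  have := hc (-h) (Hs h hh) (by rw [pr_neg]; linarith)
  rw [pr_neg] at this; linarith
lemma cell_eq0 (Hs : ∀ h ∈ H, -h ∈ H) (hc : c ∈ cell H u) {h : Fin n → ℚ} (hh : h ∈ H)
    (hu : pr h u = 0) : pr h c = 0 :=
  le_antisymm (cell_nonpos Hs hc hh hu.le) (hc h hh hu.ge)

lemma cell_sc (Hs : ∀ h ∈ H, -h ∈ H) (He : ∀ i, Pi.single i 1 ∈ H) (hc : c ∈ cell H u)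
    (hc' : -c ∈ cell H u) : c = 0 := by
  funext i
  have e1 := pr_single i c
  have e2 := pr_single i (-c)
  rcases le_total 0 (pr (Pi.single i 1) u) with h | h
  · have h1 := hc _ (He i) h
    have h2 := hc' _ (He i) h
    rw [e1] at h1; rw [e2] at h2; simp at h2 ⊢; linarith
  · have h1 := cell_nonpos Hs hc (He i) h
    have h2 := cell_nonpos Hs hc' (He i) h
    rw [e1] at h1; rw [e2] at h2; simp at h2 ⊢; linarith

lemma cell_near (hc : ∀ h ∈ H, pr h u = 0 → pr h c = 0) : ∃ t : ℝ, 0 < t ∧ u + t • c ∈ cell H u := by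
  have : ∀ᶠ t : ℝ in 𝓝[>] 0, ∀ h ∈ H, 0 ≤ pr h u → 0 ≤ pr h (u + t • c) := by
    rw [Filter.eventually_all_finset]
    intro h hh
    by_cases h0 : 0 < pr h u
    · have ht : Tendsto (fun t : ℝ => pr h u + t * pr h c) (𝓝[>] 0) (𝓝 (pr h u + 0 * pr h c)) := by
        apply Tendsto.mono_left _ nhdsWithin_le_nhds
        exact Continuous.tendsto (by fun_prop) 0
      rw [zero_mul, add_zero] at ht
      filter_upwards [ht.eventually (eventually_gt_nhds h0)] with t ht _
      rw [pr_add, pr_smul]; exact ht.le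
    · refine Eventually.of_forall (fun t hu => ?_)
      have : pr h u = 0 := le_antisymm (not_lt.1 h0) hu
      rw [pr_add, pr_smul, hc h hh this, this]; simp
  obtain ⟨t, ht, ht'⟩ := (this.and self_mem_nhdsWithin).exists
  exact ⟨t, ht', ht⟩

lemma cell_back (Hs : ∀ h ∈ H, -h ∈ H) (hc : c ∈ cell H u) :
    ∃ t : ℝ, 0 < t ∧ u - t • c ∈ cell H u := by
  obtain ⟨t, ht, h⟩ := cell_near (H := H) (u := u) (c := -c) (fun h hh h0 => by
    rw [pr_negr, cell_eq0 Hs hc hh h0, neg_zero])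
  exact ⟨t, ht, by simpa [sub_eq_add_neg] using h⟩

lemma cell_face (Hs : ∀ h ∈ H, -h ∈ H) {F : Set (Fin n → ℝ)} (hF : IsFaceOf F (cell H u)) :
    ∃ u0 ∈ cell H u, F = cell H u0 := by
  classical
  obtain ⟨w, hw, rfl⟩ := hF
  set F := {x | x ∈ cell H u ∧ dotR w x = 0}
  have h0F : (0 : Fin n → ℝ) ∈ F := ⟨cell_zero, dotR_zero _⟩
  have hch : ∀ h : Fin n → ℚ, ∃ c ∈ F, (∃ c' ∈ F, 0 < pr h c') → 0 < pr h c := by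
    intro h
    by_cases hx : ∃ c' ∈ F, 0 < pr h c'
    · obtain ⟨c', h1, h2⟩ := hx
      exact ⟨c', h1, fun _ => h2⟩
    · exact ⟨0, h0F, fun h => absurd h hx⟩
  choose g hgF hg using hch
  have hsum : ∀ s : Finset (Fin n → ℚ), ∑ h ∈ s, g h ∈ F := by
    intro s
    induction s using Finset.induction_on with
    | empty => simpa using h0F
    | insert a s ha ih =>
      rw [Finset.sum_insert ha]
      exact ⟨cell_add (hgF a).1 ih.1, by rw [dotR_add, (hgF a).2, ih.2, add_zero]⟩
  set u0 := ∑ h ∈ H, g h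
  have hu0 : u0 ∈ F := hsum H
  refine ⟨u0, hu0.1, ?_⟩
  have hp : ∀ h ∈ H, ∀ c ∈ F, 0 < pr h c → 0 < pr h u0 := by
    intro h hh c hc hpos
    have hu : 0 ≤ pr h u := by
      by_contra hcon
      have := cell_nonpos Hs hc.1 hh (not_le.1 hcon).le
      linarith
    rw [pr_sum]
    exact Finset.sum_pos' (fun k _ => (hgF k).1 h hh hu) ⟨h, hh, hg h ⟨c, hc, hpos⟩⟩
  ext c
  constructor
  · intro hc h hh hu
    by_contra hcon
    have := hp (-h) (Hs h hh) c hc (by rw [pr_neg]; linarith)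
    rw [pr_neg] at this; linarith
  · intro hc
    have hcu := cell_trans hu0.1 hc
    refine ⟨hcu, le_antisymm ?_ (hw c hcu)⟩
    obtain ⟨t, ht, hb⟩ := cell_back Hs hc
    have := hw _ (cell_trans hu0.1 hb)
    rw [dotR_sub, dotR_smul, hu0.2] at this
    nlinarith

lemma cell_inter (Hs : ∀ h ∈ H, -h ∈ H) (u u' : Fin n → ℝ) :
    IsFaceOf (cell H u ∩ cell H u') (cell H u) := by
  classical
  set B := H.filter (fun h => 0 < pr h u ∧ pr h u' ≤ 0)
  have hw : ∀ c, dotR (∑ h ∈ B, qv h) c = ∑ h ∈ B, pr h c := by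
    intro c
    rw [dotR_comm, dotR_sum]
    exact Finset.sum_congr rfl (fun h _ => dotR_comm _ _)
  have hnn : ∀ c ∈ cell H u, ∀ h ∈ B, 0 ≤ pr h c := by
    intro c hc h hh
    have := Finset.mem_filter.1 hh
    exact hc h this.1 this.2.1.le
  refine ⟨∑ h ∈ B, qv h, fun c hc => ?_, ?_⟩
  · rw [hw]
    exact Finset.sum_nonneg (hnn c hc)
  · ext c
    constructor
    · rintro ⟨h1, h2⟩
      refine ⟨h1, ?_⟩
      rw [hw]
      refine Finset.sum_eq_zero (fun h hh => le_antisymm ?_ (hnn c h1 h hh))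
      have := Finset.mem_filter.1 hh
      exact cell_nonpos Hs h2 this.1 this.2.2
    · rintro ⟨h1, h2⟩
      rw [hw, Finset.sum_eq_zero_iff_of_nonneg (hnn c h1)] at h2
      refine ⟨h1, fun h hh hu' => ?_⟩
      by_cases hu : 0 ≤ pr h u
      · exact h1 h hh hu
      · have := h2 (-h) (Finset.mem_filter.2 ⟨Hs h hh, by rw [pr_neg]; linarith, by rw [pr_neg]; linarith⟩)
        rw [pr_neg] at this; linarith

lemma cell_dual_perp (Hs : ∀ h ∈ H, -h ∈ H) {w : Fin n → ℝ} (hw : w ∈ dualSet (cell H u))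
    (h0 : dotR w u = 0) : w ∈ perpSet (cell H u) := by
  intro c hc
  obtain ⟨t, ht, hb⟩ := cell_back Hs hc
  have := hw _ hb
  rw [dotR_sub, dotR_smul, h0] at this
  have := hw c hc
  nlinarith

lemma cell_dual_pos (Hs : ∀ h ∈ H, -h ∈ H) {w : Fin n → ℝ} (hw : w ∈ dualSet (cell H u))
    (hn : w ∉ perpSet (cell H u)) : 0 < dotR w u :=
  lt_of_le_of_ne (hw u cell_self) (fun h => hn (cell_dual_perp Hs hw h.symm))

lemma cell_qv_perp (Hs : ∀ h ∈ H, -h ∈ H) {h : Fin n → ℚ} (hh : h ∈ H) (h0 : pr h u = 0) :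
    qv h ∈ perpSet (cell H u) := fun _ hc => cell_eq0 Hs hc hh h0

lemma cell_qv_dual {h : Fin n → ℚ} (hh : h ∈ H) (h0 : 0 ≤ pr h u) :
    qv h ∈ dualSet (cell H u) := fun c hc => hc h hh h0

lemma cell_qv_not_perp {h : Fin n → ℚ} (h0 : 0 < pr h u) :
    qv h ∉ perpSet (cell H u) := fun hc => h0.ne' (hc u cell_self)

end cells
end

open Filter Topology
noncomputable section

def gen {n : ℕ} (G : Finset (Fin n → ℚ)) : Set (Fin n → ℝ) :=
  {x | ∃ lam : (Fin n → ℚ) → ℝ, (∀ g, 0 ≤ lam g) ∧ x = ∑ g ∈ G, lam g • qv g}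

section gens
variable {n : ℕ} {G : Finset (Fin n → ℚ)} {x y : Fin n → ℝ}

lemma gen_add (hx : x ∈ gen G) (hy : y ∈ gen G) : x + y ∈ gen G := by
  obtain ⟨l, hl, rfl⟩ := hx
  obtain ⟨l', hl', rfl⟩ := hy
  exact ⟨fun g => l g + l' g, fun g => add_nonneg (hl g) (hl' g), by
    simp [add_smul, Finset.sum_add_distrib]⟩
lemma gen_smul {t : ℝ} (ht : 0 ≤ t) (hx : x ∈ gen G) : t • x ∈ gen G := by
  obtain ⟨l, hl, rfl⟩ := hx
  exact ⟨fun g => t * l g, fun g => mul_nonneg ht (hl g), by simp [mul_smul, Finset.smul_sum]⟩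
lemma gen_zero : (0 : Fin n → ℝ) ∈ gen G := ⟨fun _ => 0, fun _ => le_rfl, by simp⟩
lemma gen_mem {g : Fin n → ℚ} (hg : g ∈ G) : qv g ∈ gen G := by
  classical
  refine ⟨fun k => if k = g then 1 else 0, fun k => by positivity, ?_⟩
  simp [ite_smul, hg]
lemma gen_sum {ι : Type*} (s : Finset ι) (f : ι → Fin n → ℝ) (hf : ∀ i ∈ s, f i ∈ gen G) :
    ∑ i ∈ s, f i ∈ gen G := by
  classical
  induction s using Finset.induction_on with
  | empty => simpa using gen_zero
  | insert a s ha ih =>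
    rw [Finset.sum_insert ha]
    exact gen_add (hf a (Finset.mem_insert_self _ _)) (ih (fun i hi => hf i (Finset.mem_insert_of_mem hi)))

def pq {n : ℕ} (a g : Fin n → ℚ) : ℚ := ∑ i, a i * g i
lemma pr_qv (a g : Fin n → ℚ) : pr a (qv g) = ((pq a g : ℚ) : ℝ) := by
  simp [pr, dotR, qv, pq]

lemma qv_comb (s t : ℚ) (g g' : Fin n → ℚ) : qv (s • g' - t • g) = (s : ℝ) • qv g' - (t : ℝ) • qv g := by
  ext i; simp [qv]

lemma gen_step (G : Finset (Fin n → ℚ)) (a : Fin n → ℚ) : ∃ G', gen G' = gen G ∩ {x | 0 ≤ pr a x} := by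
  classical
  set Z := G.filter (fun g => 0 ≤ pq a g) with hZ
  set P := G.filter (fun g => 0 < pq a g) with hP
  set N := G.filter (fun g => ¬ 0 ≤ pq a g) with hN
  let G' := Z ∪ (P ×ˢ N).image (fun p => pq a p.1 • p.2 - pq a p.2 • p.1)
  refine ⟨G', Set.Subset.antisymm ?_ ?_⟩
  · rintro x ⟨l, hl, rfl⟩
    have key : ∀ g ∈ G', qv g ∈ gen G ∧ 0 ≤ pr a (qv g) := by
      intro g hg
      rcases Finset.mem_union.1 hg with hg | hg
      · have := Finset.mem_filter.1 hg
        exact ⟨gen_mem this.1, by rw [pr_qv]; exact_mod_cast this.2⟩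
      · obtain ⟨⟨p, q⟩, hpq, rfl⟩ := Finset.mem_image.1 hg
        obtain ⟨h1, h2⟩ := Finset.mem_product.1 hpq
        have h1 := Finset.mem_filter.1 h1
        have h2 := Finset.mem_filter.1 h2
        have e1 : (0 : ℝ) < pq a p := by exact_mod_cast h1.2
        have e2 : ((pq a q : ℚ) : ℝ) < 0 := by exact_mod_cast not_le.1 h2.2
        dsimp only
        rw [qv_comb]
        constructor
        · rw [sub_eq_add_neg, ← neg_smul]
          exact gen_add (gen_smul e1.le (gen_mem h2.1)) (gen_smul (by linarith) (gen_mem h1.1))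
        · rw [pr_sub, pr_smul, pr_smul, pr_qv, pr_qv]
          apply le_of_eq; ring
    refine ⟨gen_sum _ _ (fun g hg => gen_smul (hl g) (key g hg).1), ?_⟩
    change 0 ≤ pr a _
    rw [pr_sum]
    exact Finset.sum_nonneg (fun g hg => by rw [pr_smul]; exact mul_nonneg (hl g) (key g hg).2)
  · rintro x ⟨⟨l, hl, rfl⟩, hx⟩
    have hx : 0 ≤ pr a (∑ g ∈ G, l g • qv g) := hx
    set A : (Fin n → ℚ) → ℝ := fun g => pr a (qv g) with hA
    have hAq : ∀ g, A g = ((pq a g : ℚ) : ℝ) := fun g => pr_qv a g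
    have hNneg : ∀ g ∈ N, A g < 0 := by
      intro g hg; rw [hAq]; exact_mod_cast not_le.1 (Finset.mem_filter.1 hg).2
    have hPpos : ∀ g ∈ P, 0 < A g := by
      intro g hg; rw [hAq]; exact_mod_cast (Finset.mem_filter.1 hg).2
    set W := Z.filter (fun g => ¬ 0 < pq a g) with hW
    have hZP : Z.filter (fun g => 0 < pq a g) = P := by
      rw [hZ, hP, Finset.filter_filter]
      refine Finset.filter_congr (fun g _ => ⟨fun h => h.2, fun h => ⟨h.le, h⟩⟩)
    have hW0 : ∀ g ∈ W, A g = 0 := by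
      intro g hg
      have := Finset.mem_filter.1 hg
      have h2 := (Finset.mem_filter.1 this.1).2
      rw [hAq]; exact_mod_cast le_antisymm (not_lt.1 this.2) h2
    have split : ∀ {M : Type} [AddCommMonoid M] (f : (Fin n → ℚ) → M),
        ∑ g ∈ G, f g = (∑ g ∈ P, f g + ∑ g ∈ W, f g) + ∑ g ∈ N, f g := by
      intro M _ f
      rw [← Finset.sum_filter_add_sum_filter_not G (fun g => 0 ≤ pq a g) f,
        ← Finset.sum_filter_add_sum_filter_not Z (fun g => 0 < pq a g) f, hZP]
    have hWs : ∑ g ∈ W, l g • qv g ∈ gen G' := gen_sum _ _ (fun g hg => gen_smul (hl g) (gen_mem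
      (Finset.mem_union_left _ (Finset.mem_filter.1 hg).1)))
    have hPs : ∑ g ∈ P, l g • qv g ∈ gen G' := gen_sum _ _ (fun g hg => gen_smul (hl g) (gen_mem
      (Finset.mem_union_left _ (by rw [← hZP] at hg; exact (Finset.mem_filter.1 hg).1))))
    set p := ∑ g ∈ P, l g * A g with hp
    set q := ∑ g ∈ N, l g * A g with hq
    have hpn : 0 ≤ p := Finset.sum_nonneg (fun g hg => mul_nonneg (hl g) (hPpos g hg).le)
    have hqn : q ≤ 0 := Finset.sum_nonpos (fun g hg => mul_nonpos_of_nonneg_of_nonpos (hl g) (hNneg g hg).le)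
    have hpq : 0 ≤ p + q := by
      rw [pr_sum] at hx
      simp only [pr_smul] at hx
      rw [split] at hx
      have : ∑ g ∈ W, l g * pr a (qv g) = 0 := Finset.sum_eq_zero (fun g hg => by
        have := hW0 g hg
        simp only [hA] at this; rw [this, mul_zero])
      rw [this, add_zero] at hx
      exact hx
    rw [split]
    rcases hpn.eq_or_lt with h0 | hpos
    · have hq0 : q = 0 := by linarith
      have : ∀ g ∈ N, l g * A g = 0 := by
        rw [hq] at hq0
        exact (Finset.sum_eq_zero_iff_of_nonpos (fun g hg => mul_nonpos_of_nonneg_of_nonpos (hl g) (hNneg g hg).le)).1 hq0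
      have hl0 : ∑ g ∈ N, l g • qv g = 0 := Finset.sum_eq_zero (fun g hg => by
        rcases mul_eq_zero.1 (this g hg) with h | h
        · rw [h, zero_smul]
        · exact absurd h (hNneg g hg).ne)
      rw [hl0, add_zero]
      exact gen_add hPs hWs
    · have e : ∑ g ∈ P, ∑ g' ∈ N, (l g * l g' / p) • qv (pq a g • g' - pq a g' • g) =
          ∑ g ∈ N, l g • qv g + (-(q / p)) • ∑ g ∈ P, l g • qv g := by
        funext i
        simp only [qv_comb, ← hAq, Finset.sum_apply, Pi.add_apply, Pi.smul_apply, Pi.sub_apply, smul_eq_mul]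
        have : ∀ g g', l g * l g' / p * (A g * qv g' i - A g' * qv g i) =
          ((l g * A g) * (l g' * qv g' i) - (l g * qv g i) * (l g' * A g')) / p := by
          intro g g'; ring
        simp only [this, ← Finset.sum_div, Finset.sum_sub_distrib, ← Finset.sum_mul_sum]
        rw [← hp, ← hq]
        field_simp
        ring
      have e2 : ∑ g ∈ P, l g • qv g + ∑ g ∈ W, l g • qv g + ∑ g ∈ N, l g • qv g =
        ((1 + q / p) • ∑ g ∈ P, l g • qv g + ∑ g ∈ W, l g • qv g) +
         ∑ g ∈ P, ∑ g' ∈ N, (l g * l g' / p) • qv (pq a g • g' - pq a g' • g) := by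
        rw [e]; module
      rw [e2]
      refine gen_add (gen_add (gen_smul ?_ hPs) hWs) (gen_sum _ _ (fun g hg => gen_sum _ _ (fun g' hg' => gen_smul ?_ (gen_mem ?_))))
      · have : 1 + q / p = (p + q) / p := by field_simp
        rw [this]; positivity
      · have := hl g; have := hl g'; positivity
      · exact Finset.mem_union_right _ (Finset.mem_image.2 ⟨(g, g'), Finset.mem_product.2 ⟨hg, hg'⟩, rfl⟩)

lemma gen_univ (n : ℕ) : ∃ G : Finset (Fin n → ℚ), gen G = Set.univ := by
  classical
  refine ⟨Finset.univ.image (fun i => Pi.single i 1) ∪ Finset.univ.image (fun i => -Pi.single i 1),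
    Set.eq_univ_of_forall (fun x => ?_)⟩
  have : x = ∑ i, (max (x i) 0 • qv (Pi.single i 1) + max (-x i) 0 • qv (-Pi.single i 1)) := by
    funext j
    rw [Finset.sum_apply, Finset.sum_eq_single j]
    · simp [qv]
      rcases le_total 0 (x j) with h | h <;> simp [h]
    · intro b _ hb
      simp [qv, hb.symm]
    · simp
  rw [this]
  refine gen_sum _ _ (fun i _ => gen_add (gen_smul (le_max_right _ _) (gen_mem ?_)) (gen_smul (le_max_right _ _) (gen_mem ?_)))
  · exact Finset.mem_union_left _ (Finset.mem_image.2 ⟨i, Finset.mem_univ _, rfl⟩)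
  · exact Finset.mem_union_right _ (Finset.mem_image.2 ⟨i, Finset.mem_univ _, rfl⟩)

lemma pc_gen (L : Finset (Fin n → ℚ)) : ∃ G, gen G = pc L := by
  classical
  induction L using Finset.induction_on with
  | empty => obtain ⟨G, hG⟩ := gen_univ n; exact ⟨G, by rw [hG]; ext; simp [pc]⟩
  | insert a s ha ih =>
    obtain ⟨G, hG⟩ := ih
    obtain ⟨G', hG'⟩ := gen_step G a
    refine ⟨G', ?_⟩
    rw [hG', hG]
    ext x; simp [pc, and_comm]

lemma pc_rat (L : Finset (Fin n → ℚ)) : IsRatPolyCone (pc L) := by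
  obtain ⟨G, hG⟩ := pc_gen L
  refine ⟨G.card, fun k => (G.equivFin.symm k : Fin n → ℚ), ?_⟩
  rw [← hG]
  ext x
  constructor
  · rintro ⟨l, hl, rfl⟩
    refine ⟨fun k => l (G.equivFin.symm k), fun k => hl _, ?_⟩
    rw [← Finset.sum_coe_sort G]
    exact (Equiv.sum_comp G.equivFin.symm (fun g : G => l g • qv (g : Fin n → ℚ))).symm
  · rintro ⟨l, hl, rfl⟩
    refine gen_sum _ _ (fun k _ => gen_smul (hl k) (gen_mem (G.equivFin.symm k).2))
end gens
end

open Filter Topology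
noncomputable section

lemma lin_proj {n : ℕ} (K : Finset (Fin n → ℚ)) : ∃ g : (Fin n → ℚ) → Fin n → ℝ,
    ∀ x, ∀ h ∈ K, pr h (∑ k ∈ K, pr k x • g k) = pr h x := by
  classical
  let T : (Fin n → ℝ) →ₗ[ℝ] (K → ℝ) :=
    { toFun := fun x h => pr h x
      map_add' := fun x y => by funext h; exact pr_add _ _ _
      map_smul' := fun t x => by funext h; exact pr_smul _ _ _ }
  obtain ⟨S0, hS0⟩ := LinearMap.exists_rightInverse_of_surjective T.rangeRestrict
    (LinearMap.range_rangeRestrict T)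
  obtain ⟨S, hS⟩ := LinearMap.exists_extend S0
  refine ⟨fun k => if hk : k ∈ K then S (Pi.single ⟨k, hk⟩ 1) else 0, fun x h hh => ?_⟩
  have e1 : ∑ k ∈ K, pr k x • (if hk : k ∈ K then S (Pi.single ⟨k, hk⟩ 1) else 0) = S (T x) := by
    rw [← Finset.sum_coe_sort K]
    have : T x = ∑ k : K, pr (k : Fin n → ℚ) x • Pi.single k (1 : ℝ) := by
      funext j
      rw [Finset.sum_apply, Finset.sum_eq_single j]
      · simp [T]
      · intro b _ hb; simp [hb.symm]
      · simp
    rw [this, map_sum]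
    refine Finset.sum_congr rfl (fun k _ => ?_)
    rw [dif_pos k.2, map_smul]
  rw [e1]
  have e2 : S (T x) = S0 (T.rangeRestrict x) := by
    rw [← hS]; rfl
  have e3 : T (S0 (T.rangeRestrict x)) = T x := by
    have := LinearMap.congr_fun hS0 (T.rangeRestrict x)
    exact congrArg Subtype.val this
  rw [e2]
  exact congrFun e3 ⟨h, hh⟩

def lgv {n : ℕ} (x : Fin n → ℝ) : Fin n → ℝ := fun i => Real.log (x i)

lemma mPow_eq {n : ℕ} {x : Fin n → ℝ} (hx : ∀ i, 0 < x i) (w : Fin n → ℝ) :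
    mPow x w = Real.exp (dotR w (lgv x)) := by
  rw [mPow, dotR, Real.exp_sum]
  refine Finset.prod_congr rfl (fun i _ => ?_)
  rw [Real.rpow_def_of_pos (hx i), lgv, mul_comm]

def Appr {n m : ℕ} (V : Set ((Fin n → ℝ) × (Fin m → ℝ))) (v : Fin n → ℝ) (z : Fin m → ℝ) (η : ℝ)
    (c : Fin n → ℝ) : Prop :=
  ∃ x ∈ V, (∀ i, |lgv x.1 i + c i - v i| < η) ∧ ∀ j, |x.2 j - z j| < η

def KeyP {n m : ℕ} (V : Set ((Fin n → ℝ) × (Fin m → ℝ))) (H : Finset (Fin n → ℚ)) : Prop :=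
  ∀ u y z0 ε δ, ∃ R, ∀ c c', Deep H u R c → Deep H u R c' → Phi V y z0 ε δ c → Phi V y z0 ε δ c'

section
variable {n m : ℕ} {V : Set ((Fin n → ℝ) × (Fin m → ℝ))} {H : Finset (Fin n → ℚ)}

lemma lemA (hpos : ∀ x ∈ V, ∀ i, 0 < x.1 i) (Hs : ∀ h ∈ H, -h ∈ H) (hK : KeyP V H)
    {u v : Fin n → ℝ} {z : Fin m → ℝ} {φ : ↥(perpSet (cell H u)) → ℝ}
    (h0 : ∀ w, φ w = Real.exp (dotR v w)) (hL : (φ, z) ∈ limitSet m (cell H u) V) :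
    ∀ η > 0, ∃ R, ∀ c, Deep H u R c → Appr V v z η c := by
  classical
  intro η hη
  obtain ⟨_, x, hxV, hz, hperp, hdual⟩ := hL
  dsimp only at hz hperp hdual
  have hlog : ∀ i, ∀ᶠ e in 𝓝[>] (0 : ℝ), ∀ t, |t - Real.exp (v i)| < e → |Real.log t - v i| < η := by
    intro i
    have := Metric.continuousAt_iff.1 (Real.continuousAt_log (Real.exp_pos (v i)).ne') η hη
    obtain ⟨d, hd, h⟩ := this
    filter_upwards [Ioo_mem_nhdsGT hd] with e he t ht
    have := h (show dist t _ < d by rw [Real.dist_eq]; exact ht.trans he.2)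
    rwa [Real.dist_eq, Real.log_exp] at this
  obtain ⟨ε, hε, hε0, hεη⟩ := ((eventually_all.2 hlog).and (Ioo_mem_nhdsGT hη)).exists
  obtain ⟨R, hR⟩ := hK u (fun i => Real.exp (v i)) z ε 1
  refine ⟨R, fun c hc => ?_⟩
  set K := H.filter (fun h => pr h u = 0) with hKd
  obtain ⟨g, hg⟩ := lin_proj K
  set d : ℕ → Fin n → ℝ := fun k => v - lgv (x k).1 with hd
  set b : ℕ → Fin n → ℝ := fun k => ∑ h ∈ K, pr h (d k) • g h with hb
  have hd0 : ∀ h ∈ K, Tendsto (fun k => pr h (d k)) atTop (𝓝 0) := by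
    intro h hh
    have hh' := Finset.mem_filter.1 hh
    have hp := cell_qv_perp Hs hh'.1 hh'.2
    have h1 := hperp (qv h) (cell_qv_dual hh'.1 hh'.2.ge) hp
    rw [h0] at h1
    have h2 := (Real.continuousAt_log (Real.exp_pos (dotR v (qv h))).ne').tendsto.comp h1
    rw [Real.log_exp] at h2
    have h3 := h2.const_sub (dotR v (qv h))
    rw [sub_self] at h3
    refine h3.congr (fun k => ?_)
    simp only [Function.comp_apply, hd]
    rw [mPow_eq (hpos _ (hxV k)), Real.log_exp, pr_sub, pr, pr, dotR_comm v]
  have hb0 : Tendsto b atTop (𝓝 0) := by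
    have : Tendsto b atTop (𝓝 (∑ h ∈ K, (0 : ℝ) • g h)) :=
      tendsto_finsetSum _ (fun h hh => (hd0 h hh).smul_const (g h))
    simpa using this
  have hdeep : ∀ᶠ k in atTop, Deep H u R (d k - b k) := by
    have : ∀ᶠ k in atTop, ∀ h ∈ H, 0 < pr h u → R ≤ pr h (d k - b k) := by
      rw [Filter.eventually_all_finset]
      intro h hh
      by_cases hu : 0 < pr h u
      swap
      · exact Eventually.of_forall (fun k h => absurd h hu)
      have h1 := hdual (qv h) (cell_qv_dual hh hu.le) (cell_qv_not_perp hu)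
      have h2 : Tendsto (fun k => dotR (qv h) (lgv (x k).1)) atTop atBot := by
        rw [← Real.tendsto_exp_comp_nhds_zero]
        refine h1.congr (fun k => ?_)
        rw [mPow_eq (hpos _ (hxV k))]
      have h3 : Tendsto (fun k => pr h (v - b k)) atTop (𝓝 (pr h (v - 0))) :=
        ((continuous_dotR (qv h)).tendsto _).comp (hb0.const_sub v)
      have h4 := h3.add_atTop (tendsto_neg_atBot_atTop.comp h2)
      filter_upwards [h4.eventually (eventually_ge_atTop R)] with k hk _
      simp only [Function.comp_apply] at hk
      rw [pr_sub] at hk ⊢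
      simp only [hd]
      rw [pr_sub]
      simp only [pr] at hk ⊢
      linarith
    filter_upwards [this] with k hk h hh
    refine ⟨fun hu => ?_, hk h hh⟩
    rw [pr_sub, hb, hg (d k) h (Finset.mem_filter.2 ⟨hh, hu⟩), sub_self]
  have hph : ∀ᶠ k in atTop, Phi V (fun i => Real.exp (v i)) z ε 1 (d k - b k) := by
    have h1 : ∀ i, ∀ᶠ k in atTop, |(x k).1 i * Real.exp ((d k - b k) i) - Real.exp (v i)| < ε := by
      intro i
      have : Tendsto (fun k => Real.exp (v i - b k i)) atTop (𝓝 (Real.exp (v i - 0))) :=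
        (Real.continuous_exp.tendsto _).comp (((tendsto_pi_nhds.1 hb0) i).const_sub (v i))
      rw [sub_zero] at this
      filter_upwards [Metric.tendsto_nhds.1 this ε hε0] with k hk
      rw [Real.dist_eq] at hk
      convert hk using 3
      have e : (d k - b k) i = (v i - b k i) - Real.log ((x k).1 i) := by
        simp [hd, lgv]; ring
      rw [e, Real.exp_sub _ (Real.log _), Real.exp_log (hpos _ (hxV k) i)]
      have := hpos _ (hxV k) i
      field_simp
    have h2 : ∀ j, ∀ᶠ k in atTop, |1 * ((x k).2 j - z j)| < ε := by
      intro j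
      filter_upwards [Metric.tendsto_nhds.1 ((tendsto_pi_nhds.1 hz) j) ε hε0] with k hk
      rw [one_mul]; exact hk
    filter_upwards [eventually_all.2 h1, eventually_all.2 h2] with k h1 h2
    exact ⟨x k, hxV k, h1, h2⟩
  obtain ⟨k, hk1, hk2⟩ := (hdeep.and hph).exists
  obtain ⟨y, hy, hy1, hy2⟩ := hR _ _ hk1 hc hk2
  refine ⟨y, hy, fun i => ?_, fun j => ?_⟩
  · have := hε i _ (hy1 i)
    rwa [Real.log_mul (hpos y hy i).ne' (Real.exp_pos _).ne', Real.log_exp] at this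
  · have := hy2 j
    rw [one_mul] at this
    exact this.trans hεη
end
end

open Filter Topology
noncomputable section

lemma ultra_tri (U : Ultrafilter ℕ) (f : ℕ → ℝ) :
    (∃ B, ∀ᶠ k in (U : Filter ℕ), |f k| ≤ B) ∨ Tendsto f U atTop ∨ Tendsto f U atBot := by
  by_cases h : ∃ B, ∀ᶠ k in (U : Filter ℕ), |f k| ≤ B
  · exact Or.inl h
  right
  push Not at h
  have h' : ∀ B, ∀ᶠ k in (U : Filter ℕ), B < |f k| := by
    intro B
    exact h B
  rcases U.em (fun k => 0 ≤ f k) with h0 | h0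
  · left
    refine tendsto_atTop.2 (fun B => ?_)
    filter_upwards [h0, h' B] with k h1 h2
    rw [abs_of_nonneg h1] at h2; exact h2.le
  · right
    refine tendsto_atBot.2 (fun B => ?_)
    filter_upwards [h0, h' (-B)] with k h1 h2
    rw [abs_of_neg (not_le.1 h1)] at h2; linarith

lemma bdd_window {B t : ℝ} (ht : 0 < t) :
    |t - (Real.exp B + Real.exp (-B)) / 2| < (Real.exp B - Real.exp (-B)) / 2 ↔ |Real.log t| < B := by
  rw [abs_lt, abs_lt, Real.lt_log_iff_exp_lt ht, Real.log_lt_iff_lt_exp ht]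
  constructor
  · rintro ⟨h1, h2⟩; constructor <;> linarith
  · rintro ⟨h1, h2⟩; constructor <;> linarith

section
variable {n m : ℕ} {V : Set ((Fin n → ℝ) × (Fin m → ℝ))} {H : Finset (Fin n → ℚ)}

lemma abs_pr_le (h : Fin n → ℚ) {b : Fin n → ℝ} {B : ℝ} (hb : ∀ i, |b i| ≤ B) :
    |pr h b| ≤ (∑ i, |qv h i|) * B := by
  rw [pr, dotR, Finset.sum_mul]
  refine (Finset.abs_sum_le_sum_abs _ _).trans (Finset.sum_le_sum (fun i _ => ?_))
  rw [abs_mul]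
  exact mul_le_mul_of_nonneg_left (hb i) (abs_nonneg _)

lemma trop_cell (hpos : ∀ x ∈ V, ∀ i, 0 < x.1 i) (Hs : ∀ h ∈ H, -h ∈ H) (hK : KeyP V H)
    {u u' : Fin n → ℝ} (hu : u ∈ tropSet n m V) (hu' : u' ∈ cell H u) : u' ∈ tropSet n m V := by
  classical
  obtain ⟨x, e, hxV, he, he0, hlim⟩ := hu
  let U : Ultrafilter ℕ := hyperfilter ℕ
  have hU : (U : Filter ℕ) ≤ atTop := Nat.hyperfilter_le_atTop
  set a : ℕ → Fin n → ℝ := fun k => - lgv (x k).1 with ha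
  set K := H.filter (fun h => ∃ B, ∀ᶠ k in (U : Filter ℕ), |pr h (a k)| ≤ B) with hKd
  obtain ⟨g, hg⟩ := lin_proj K
  set b : ℕ → Fin n → ℝ := fun k => ∑ h ∈ K, pr h (a k) • g h with hb
  set c : ℕ → Fin n → ℝ := fun k => a k - b k with hcd
  have hBh : ∀ h : Fin n → ℚ, ∃ B, h ∈ K → ∀ᶠ k in (U : Filter ℕ), |pr h (a k)| ≤ B := by
    intro h
    by_cases hh : h ∈ K
    · obtain ⟨B, hB⟩ := (Finset.mem_filter.1 hh).2
      exact ⟨B, fun _ => hB⟩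
    · exact ⟨0, fun h => absurd h hh⟩
  choose Bh hBh using hBh
  obtain ⟨B, hB⟩ : ∃ B : ℝ, ∀ᶠ k in (U : Filter ℕ), ∀ i, |b k i| ≤ B := by
    refine ⟨∑ h ∈ K, Bh h * ∑ i, |g h i|, ?_⟩
    have : ∀ᶠ k in (U : Filter ℕ), ∀ h ∈ K, |pr h (a k)| ≤ Bh h := by
      rw [Filter.eventually_all_finset]
      exact fun h hh => hBh h hh
    filter_upwards [this] with k hk i
    simp only [hb, Finset.sum_apply, Pi.smul_apply, smul_eq_mul]
    refine (Finset.abs_sum_le_sum_abs _ _).trans (Finset.sum_le_sum (fun h hh => ?_))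
    rw [abs_mul]
    refine mul_le_mul (hk h hh) (Finset.single_le_sum (f := fun i => |g h i|) (fun _ _ => abs_nonneg _) (Finset.mem_univ i)) (abs_nonneg _) ((abs_nonneg _).trans (hk h hh))
  have hcK : ∀ h ∈ K, ∀ k, pr h (c k) = 0 := by
    intro h hh k
    simp only [hcd]
    rw [pr_sub, hb, hg (a k) h hh, sub_self]
  have hcT : ∀ h ∈ H, h ∉ K → Tendsto (fun k => pr h (c k)) U atTop ∨ Tendsto (fun k => pr h (c k)) U atBot := by
    intro h hh hhK
    have h3 : ∀ᶠ k in (U : Filter ℕ), |pr h (b k)| ≤ (∑ i, |qv h i|) * B := by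
      filter_upwards [hB] with k hk
      exact abs_pr_le h hk
    rcases ultra_tri U (fun k => pr h (a k)) with h1 | h1 | h1
    · exact absurd (Finset.mem_filter.2 ⟨hh, h1⟩) hhK
    · left
      refine tendsto_atTop_mono' _ ?_ (tendsto_atTop_add_const_right _ (-((∑ i, |qv h i|) * B)) h1)
      filter_upwards [h3] with k hk
      have := abs_le.1 hk
      simp only [hcd]; rw [pr_sub]; linarith
    · right
      refine tendsto_atBot_mono' _ ?_ (tendsto_atBot_add_const_right _ ((∑ i, |qv h i|) * B) h1)
      filter_upwards [h3] with k hk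
      have := abs_le.1 hk
      simp only [hcd]; rw [pr_sub]; linarith
  -- choose the base point
  obtain ⟨k0, hk0⟩ : ∃ k0, ∀ h ∈ H, (Tendsto (fun k => pr h (c k)) U atTop → 0 < pr h (c k0)) ∧
      (Tendsto (fun k => pr h (c k)) U atBot → pr h (c k0) < 0) := by
    have : ∀ᶠ k in (U : Filter ℕ), ∀ h ∈ H, (Tendsto (fun k => pr h (c k)) U atTop → 0 < pr h (c k)) ∧
      (Tendsto (fun k => pr h (c k)) U atBot → pr h (c k) < 0) := by
      rw [Filter.eventually_all_finset]
      intro h hh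
      refine Filter.Eventually.and ?_ ?_
      · by_cases hT : Tendsto (fun k => pr h (c k)) U atTop
        · filter_upwards [hT.eventually (eventually_gt_atTop 0)] with k hk _ using hk
        · exact Eventually.of_forall (fun k h => absurd h hT)
      · by_cases hT : Tendsto (fun k => pr h (c k)) U atBot
        · filter_upwards [hT.eventually (eventually_lt_atBot 0)] with k hk _ using hk
        · exact Eventually.of_forall (fun k h => absurd h hT)
    exact this.exists
  set w := c k0 with hw
  have hdeep : ∀ R, ∀ᶠ k in (U : Filter ℕ), Deep H w R (c k) := by
    intro R
    have : ∀ᶠ k in (U : Filter ℕ), ∀ h ∈ H, (pr h w = 0 → pr h (c k) = 0) ∧ (0 < pr h w → R ≤ pr h (c k)) := by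
      rw [Filter.eventually_all_finset]
      intro h hh
      by_cases hhK : h ∈ K
      · refine Eventually.of_forall (fun k => ⟨fun _ => hcK h hhK k, fun h2 => ?_⟩)
        rw [hw, hcK h hhK] at h2; exact absurd h2 (lt_irrefl _)
      · rcases hcT h hh hhK with hT | hT
        · have := (hk0 h hh).1 hT
          filter_upwards [hT.eventually (eventually_ge_atTop R)] with k hk
          exact ⟨fun h => absurd h this.ne', fun _ => hk⟩
        · have := (hk0 h hh).2 hT
          exact Eventually.of_forall (fun k => ⟨fun h => absurd h this.ne, fun h => absurd h this.not_gt⟩)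
    exact this
  have hlimU : Tendsto (fun k => e k • c k) U (𝓝 u) := by
    have h1 : Tendsto (fun k => e k • b k) U (𝓝 0) := by
      rw [tendsto_pi_nhds]
      intro i
      have h2 : Tendsto (fun k => e k * B) U (𝓝 0) := by
        have := (he0.mono_left hU).mul_const B
        rwa [zero_mul] at this
      refine squeeze_zero_norm' ?_ h2
      filter_upwards [hB] with k hk
      rw [Pi.smul_apply, smul_eq_mul, Real.norm_eq_abs, abs_mul, abs_of_pos (he k)]
      exact mul_le_mul_of_nonneg_left (hk i) (he k).le
    have h3 := (hlim.mono_left hU).sub h1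
    rw [sub_zero] at h3
    refine h3.congr (fun k => ?_)
    funext i
    simp [hcd, ha, lgv]; ring
  have huw : u ∈ cell H w := by
    intro h hh hw0
    have h1 : Tendsto (fun k => pr h (e k • c k)) U (𝓝 (pr h u)) :=
      ((continuous_dotR (qv h)).tendsto _).comp hlimU
    refine ge_of_tendsto h1 ?_
    filter_upwards [hdeep 0] with k hk
    rw [pr_smul]
    refine mul_nonneg (he k).le ?_
    rcases hw0.eq_or_lt with h2 | h2
    · exact ((hk h hh).1 h2.symm).ge
    · exact (hk h hh).2 h2
  have hu'w : u' ∈ cell H w := cell_trans huw hu'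
  obtain ⟨B1, hB1, hBB⟩ : ∃ B1 : ℝ, 0 < B1 ∧ B < B1 := ⟨max B 0 + 1, by positivity, by
    have := le_max_left B 0; linarith⟩
  have hwin : 0 < (Real.exp B1 - Real.exp (-B1)) / 2 := by
    have : Real.exp (-B1) < Real.exp B1 := Real.exp_lt_exp.2 (by linarith)
    linarith
  obtain ⟨R, hR⟩ := hK w (fun _ => (Real.exp B1 + Real.exp (-B1)) / 2) 0
    ((Real.exp B1 - Real.exp (-B1)) / 2) 0
  obtain ⟨k1, hk1, hk1B⟩ := ((hdeep R).and hB).exists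
  have hall : ∀ c', Deep H w R c' → ∃ y ∈ V, ∀ i, |lgv y.1 i + c' i| < B1 := by
    intro c' hc'
    have hph : Phi V (fun _ => (Real.exp B1 + Real.exp (-B1)) / 2) 0
      ((Real.exp B1 - Real.exp (-B1)) / 2) 0 (c k1) := by
      refine ⟨x k1, hxV k1, fun i => ?_, fun j => by rw [zero_mul, abs_zero]; exact hwin⟩
      have hp := hpos _ (hxV k1) i
      rw [bdd_window (mul_pos hp (Real.exp_pos _)), Real.log_mul hp.ne' (Real.exp_pos _).ne', Real.log_exp]
      have : Real.log ((x k1).1 i) + c k1 i = - b k1 i := by simp [hcd, ha, lgv]; ring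
      rw [this, abs_neg]
      exact (hk1B i).trans_lt hBB
    obtain ⟨y, hy, hy1, _⟩ := hR _ _ hk1 hc' hph
    refine ⟨y, hy, fun i => ?_⟩
    have hp := hpos y hy i
    have := hy1 i
    rwa [bdd_window (mul_pos hp (Real.exp_pos _)), Real.log_mul hp.ne' (Real.exp_pos _).ne', Real.log_exp] at this
  have hev : ∀ᶠ r : ℕ in atTop, Deep H w R (((r : ℝ) ^ 2) • u' + (r : ℝ) • w) := by
    have : ∀ᶠ r : ℕ in atTop, ∀ h ∈ H, (pr h w = 0 → pr h (((r : ℝ) ^ 2) • u' + (r : ℝ) • w) = 0) ∧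
        (0 < pr h w → R ≤ pr h (((r : ℝ) ^ 2) • u' + (r : ℝ) • w)) := by
      rw [Filter.eventually_all_finset]
      intro h hh
      by_cases h0 : 0 < pr h w
      · have h1 : Tendsto (fun r : ℕ => (r : ℝ) * pr h w) atTop atTop :=
          tendsto_natCast_atTop_atTop.atTop_mul_const h0
        filter_upwards [h1.eventually (eventually_ge_atTop R)] with r hr
        refine ⟨fun h => absurd h h0.ne', fun _ => ?_⟩
        rw [pr_add, pr_smul, pr_smul]
        have := mul_nonneg (sq_nonneg (r : ℝ)) (hu'w h hh h0.le)
        linarith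
      · refine Eventually.of_forall (fun r => ⟨fun h1 => ?_, fun h1 => absurd h1 h0⟩)
        rw [pr_add, pr_smul, pr_smul, h1, cell_eq0 Hs hu'w hh h1]; simp
    exact this
  obtain ⟨N, hN⟩ := eventually_atTop.1 hev
  have hch : ∀ k : ℕ, ∃ y ∈ V, ∀ i, |lgv y.1 i + ((((k + N + 1 : ℕ) : ℝ) ^ 2) • u' + ((k + N + 1 : ℕ) : ℝ) • w) i| < B1 :=
    fun k => hall _ (hN (k + N + 1) (by omega))
  choose y hyV hy using hch
  have hr : Tendsto (fun k : ℕ => ((k + N + 1 : ℕ) : ℝ)) atTop atTop := by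
    refine tendsto_natCast_atTop_atTop.comp ?_
    exact tendsto_atTop_mono (fun k => by simp only [id]; omega) tendsto_id
  have hinv : Tendsto (fun k : ℕ => (((k + N + 1 : ℕ) : ℝ))⁻¹) atTop (𝓝 0) := hr.inv_tendsto_atTop
  have hinv2 : Tendsto (fun k : ℕ => ((((k + N + 1 : ℕ) : ℝ))⁻¹) ^ 2) atTop (𝓝 0) := by
    simpa using hinv.pow 2
  have hrp : ∀ k : ℕ, (0 : ℝ) < ((k + N + 1 : ℕ) : ℝ) := fun k => by positivity
  refine ⟨y, fun k => ((((k + N + 1 : ℕ) : ℝ))⁻¹) ^ 2, hyV, fun k => by have := hrp k; positivity, hinv2, ?_⟩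
  rw [tendsto_pi_nhds]
  intro i
  have h1 : Tendsto (fun k : ℕ => ((((k + N + 1 : ℕ) : ℝ))⁻¹) ^ 2 * (lgv (y k).1 i + ((((k + N + 1 : ℕ) : ℝ) ^ 2) • u' + ((k + N + 1 : ℕ) : ℝ) • w) i)) atTop (𝓝 0) := by
    have h2 : Tendsto (fun k : ℕ => ((((k + N + 1 : ℕ) : ℝ))⁻¹) ^ 2 * B1) atTop (𝓝 0) := by
      simpa using hinv2.mul_const B1
    refine squeeze_zero_norm (fun k => ?_) h2
    rw [Real.norm_eq_abs, abs_mul, abs_of_nonneg (sq_nonneg _)]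
    exact mul_le_mul_of_nonneg_left (hy k i).le (sq_nonneg _)
  have h2 := ((hinv.mul_const (w i)).const_add (u' i)).sub h1
  simp only [zero_mul, add_zero, sub_zero] at h2
  refine h2.congr (fun k => ?_)
  have := (hrp k).ne'
  simp only [Pi.add_apply, Pi.smul_apply, smul_eq_mul, lgv]
  field_simp
  ring
end
end

open Filter Topology
noncomputable section

section
variable {n m : ℕ} {V : Set ((Fin n → ℝ) × (Fin m → ℝ))} {H : Finset (Fin n → ℚ)}

lemma limit_of (hpos : ∀ x ∈ V, ∀ i, 0 < x.1 i) {σ : Set (Fin n → ℝ)} {v : Fin n → ℝ} {z : Fin m → ℝ}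
    (x : ℕ → (Fin n → ℝ) × (Fin m → ℝ)) (hx : ∀ k, x k ∈ V)
    (hz : Tendsto (fun k => (x k).2) atTop (𝓝 z)) (c : ℕ → Fin n → ℝ)
    (hb : Tendsto (fun k => lgv (x k).1 + c k) atTop (𝓝 v))
    (h1 : ∀ w ∈ perpSet σ, ∀ k, dotR w (c k) = 0)
    (h2 : ∀ w ∈ dualSet σ, w ∉ perpSet σ → Tendsto (fun k => dotR w (c k)) atTop atTop) :
    ((fun w : ↥(perpSet σ) => Real.exp (dotR v (w : Fin n → ℝ))), z) ∈ limitSet m σ V := by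
  have hd : ∀ w, Tendsto (fun k => dotR w (lgv (x k).1 + c k)) atTop (𝓝 (dotR w v)) := fun w =>
    ((continuous_dotR w).tendsto _).comp hb
  refine ⟨⟨v, fun w => rfl⟩, x, hx, hz, fun w hw hw' => ?_, fun w hw hw' => ?_⟩
  · have := (Real.continuous_exp.tendsto _).comp (hd w)
    dsimp only
    rw [dotR_comm v w]
    refine this.congr (fun k => ?_)
    rw [mPow_eq (hpos _ (hx k)), Function.comp_apply, dotR_add, h1 w hw' k, add_zero]
  · have h3 := (hd w).add_atBot (tendsto_neg_atTop_atBot.comp (h2 w hw hw'))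
    refine (Real.tendsto_exp_comp_nhds_zero.2 h3).congr (fun k => ?_)
    rw [mPow_eq (hpos _ (hx k)), Function.comp_apply, dotR_add]
    congr 1; ring

lemma deep_smul {u s : Fin n → ℝ} (h0 : ∀ h ∈ H, pr h u = 0 → pr h s = 0)
    (h1 : ∀ h ∈ H, 0 < pr h u → 0 < pr h s) (R : ℝ) : ∀ᶠ t : ℝ in atTop, Deep H u R (t • s) := by
  have : ∀ᶠ t : ℝ in atTop, ∀ h ∈ H, (pr h u = 0 → pr h (t • s) = 0) ∧ (0 < pr h u → R ≤ pr h (t • s)) := by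
    rw [Filter.eventually_all_finset]
    intro h hh
    by_cases hp : 0 < pr h u
    · have h2 : Tendsto (fun t : ℝ => t * pr h s) atTop atTop :=
        tendsto_id.atTop_mul_const (h1 h hh hp)
      filter_upwards [h2.eventually (eventually_ge_atTop R)] with t ht
      refine ⟨fun h => absurd h hp.ne', fun _ => ?_⟩
      rw [pr_smul]; exact ht
    · refine Eventually.of_forall (fun t => ⟨fun h2 => ?_, fun h => absurd h hp⟩)
      rw [pr_smul, h0 h hh h2, mul_zero]
  exact this

lemma intr_ext {s : Set (Fin n → ℝ)} {u c : Fin n → ℝ} (hu : u ∈ intrinsicInterior ℝ s) (hc : c ∈ s) :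
    ∃ t : ℝ, 0 < t ∧ u - t • (c - u) ∈ s := by
  obtain ⟨y, hy, rfl⟩ := mem_intrinsicInterior.1 hu
  have hcA : c ∈ affineSpan ℝ s := subset_affineSpan ℝ s hc
  let f : ℝ → affineSpan ℝ s := fun t => ⟨AffineMap.lineMap (y : Fin n → ℝ) c (-t), AffineMap.lineMap_mem _ y.2 hcA⟩
  have hf : Continuous f := by
    refine Continuous.subtype_mk ?_ _
    exact (AffineMap.lineMap_continuous).comp continuous_neg
  have h0 : f 0 = y := by
    apply Subtype.ext
    simp [f]
  have h1 : ∀ᶠ t in 𝓝 (0 : ℝ), f t ∈ ((↑) ⁻¹' s : Set (affineSpan ℝ s)) := by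
    have := hf.tendsto 0
    rw [h0] at this
    exact this.eventually (mem_interior_iff_mem_nhds.1 hy)
  have h2 : ∀ᶠ t in 𝓝[>] (0 : ℝ), f t ∈ ((↑) ⁻¹' s : Set (affineSpan ℝ s)) := h1.filter_mono nhdsWithin_le_nhds
  obtain ⟨t, ht, htp⟩ := (h2.and self_mem_nhdsWithin).exists
  refine ⟨t, htp, ?_⟩
  have : ((f t : affineSpan ℝ s) : Fin n → ℝ) = (y : Fin n → ℝ) - t • (c - y) := by
    simp [f, AffineMap.lineMap_apply]
    module
  rw [← this]
  exact ht

lemma intr_pos {s : Set (Fin n → ℝ)} {u w : Fin n → ℝ} (hu : u ∈ intrinsicInterior ℝ s)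
    (hw : w ∈ dualSet s) (hw' : w ∉ perpSet s) : 0 < dotR w u := by
  refine lt_of_le_of_ne (hw u (intrinsicInterior_subset hu)) (fun h0 => hw' (fun c hc => ?_))
  obtain ⟨t, ht, hs⟩ := intr_ext hu hc
  have h1 := hw _ hs
  have h2 := hw c hc
  rw [dotR_sub, dotR_smul, dotR_sub, ← h0] at h1
  nlinarith

lemma tendsto_of_lt {ι : Type*} [Fintype ι] {f : ℕ → ι → ℝ} {v : ι → ℝ}
    (h : ∀ k i, |f k i - v i| ≤ 1 / ((k : ℝ) + 1)) : Tendsto f atTop (𝓝 v) := by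
  rw [tendsto_pi_nhds]
  intro i
  rw [tendsto_iff_dist_tendsto_zero]
  exact squeeze_zero (fun _ => dist_nonneg) (fun k => by rw [Real.dist_eq]; exact h k i)
    tendsto_one_div_add_atTop_nhds_zero_nat

lemma part2 (hpos : ∀ x ∈ V, ∀ i, 0 < x.1 i) (Hs : ∀ h ∈ H, -h ∈ H) (hK : KeyP V H)
    (u : Fin n → ℝ) (σ' : Set (Fin n → ℝ)) (hσ' : IsSCCone σ') (hsub : σ' ⊆ cell H u)
    (hne : (σ' ∩ intrinsicInterior ℝ (cell H u)).Nonempty) :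
    limitSet m σ' V =
          {p : (↥(perpSet σ') → ℝ) × (Fin m → ℝ) | p.1 ∈ orbitSet σ'} ∩
            (fun p : (↥(perpSet σ') → ℝ) × (Fin m → ℝ) =>
              (restrictOrbit σ' (cell H u) hsub p.1, p.2)) ⁻¹' limitSet m (cell H u) V := by
  obtain ⟨u1, hu1, hu1i⟩ := hne
  obtain ⟨hcl, hcv, h0, hsm, _⟩ := hσ'
  ext ⟨φ, z⟩
  constructor
  · rintro ⟨⟨v, hv⟩, x, hx, hz, h1, h2⟩
    refine ⟨⟨v, hv⟩, ⟨v, fun w => hv _⟩, x, hx, hz, fun w hw hw' => ?_, fun w hw hw' => ?_⟩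
    · exact h1 w (fun c hc => hw c (hsub hc)) (fun c hc => hw' c (hsub hc))
    · refine h2 w (fun c hc => hw c (hsub hc)) (fun hc => ?_)
      exact (intr_pos hu1i hw hw').ne' (hc u1 hu1)
  · rintro ⟨⟨v, hv⟩, hL⟩
    dsimp only at hv
    have hL : (restrictOrbit σ' (cell H u) hsub φ, z) ∈ limitSet m (cell H u) V := hL
    have hA := lemA hpos Hs hK (v := v) (fun w => hv _) hL
    obtain ⟨u2, hu2⟩ := Set.Nonempty.intrinsicInterior hcv ⟨0, h0⟩
    have hu2' := intrinsicInterior_subset hu2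
    set s := u1 + u2 with hs
    have hsσ : s ∈ σ' := by
      have := hsm _ (hcv hu1 hu2' (a := 1/2) (b := 1/2) (by norm_num) (by norm_num) (by norm_num)) 2 (by norm_num)
      convert this using 1
      rw [hs]; module
    have hdp : ∀ R, ∀ᶠ t : ℝ in atTop, Deep H u R (t • s) := by
      refine deep_smul (fun h hh hp => cell_eq0 Hs (hsub hsσ) hh hp) (fun h hh hp => ?_)
      rw [hs, pr_add]
      have h1 : 0 < pr h u1 := intr_pos hu1i (cell_qv_dual hh hp.le) (cell_qv_not_perp hp)
      have h2 := hsub hu2' h hh hp.le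
      linarith
    have hex : ∀ k : ℕ, ∃ t : ℝ, (k : ℝ) ≤ t ∧ Appr V v z (1 / ((k : ℝ) + 1)) (t • s) := by
      intro k
      obtain ⟨R, hR⟩ := hA (1 / ((k : ℝ) + 1)) (by positivity)
      obtain ⟨t, h1, h2⟩ := ((hdp R).and (eventually_ge_atTop (k : ℝ))).exists
      exact ⟨t, h2, hR _ h1⟩
    choose t ht x hxV hx hz using hex
    have : φ = fun w : ↥(perpSet σ') => Real.exp (dotR v (w : Fin n → ℝ)) := funext hv
    rw [this]
    refine limit_of hpos x hxV (tendsto_of_lt (fun k i => (hz k i).le)) (fun k => t k • s)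
      (tendsto_of_lt (fun k i => (hx k i).le)) (fun w hw k => ?_) (fun w hw hw' => ?_)
    · rw [dotR_smul, hw s hsσ, mul_zero]
    · simp only [dotR_smul]
      refine Tendsto.atTop_mul_const ?_ (tendsto_atTop_mono ht tendsto_natCast_atTop_atTop)
      rw [hs, dotR_add]
      have h1 := hw u1 hu1
      have h2 := intr_pos hu2 hw hw'
      linarith

lemma abs_dotR_le (w v : Fin n → ℝ) : |dotR w v| ≤ (∑ i, |w i|) * ∑ i, |v i| := by
  rw [dotR, Finset.sum_mul]
  refine (Finset.abs_sum_le_sum_abs _ _).trans (Finset.sum_le_sum (fun i _ => ?_))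
  rw [abs_mul]
  exact mul_le_mul_of_nonneg_left (Finset.single_le_sum (f := fun i => |v i|) (fun _ _ => abs_nonneg _)
    (Finset.mem_univ i)) (abs_nonneg _)

lemma part1b (hpos : ∀ x ∈ V, ∀ i, 0 < x.1 i) (Hs : ∀ h ∈ H, -h ∈ H) (hK : KeyP V H)
    (s t : Fin n → ℝ) (hst : cell H s ⊆ cell H t) :
    relLimitSet m (cell H s) (cell H t) (limitSet m (cell H s) V) ⊆ limitSet m (cell H t) V := by
  rintro ⟨φ, z⟩ ⟨hφ, ψ, hψ, hz, h1, h2⟩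
  dsimp only at hφ hz h1 h2
  have hv : ∀ k, ∃ v : Fin n → ℝ, ∀ w, (ψ k).1 w = Real.exp (dotR v w) := fun k => (hψ k).1
  choose v hv using hv
  have hex : ∀ k : ℕ, ∃ r : ℝ, (k : ℝ) * (1 + ∑ i, |v k i|) ≤ r ∧
      Appr V (v k) (ψ k).2 (1 / ((k : ℝ) + 1)) (r • s) := by
    intro k
    obtain ⟨R, hR⟩ := lemA hpos Hs hK (hv k) (hψ k) (1 / ((k : ℝ) + 1)) (by positivity)
    obtain ⟨r, h1, h2⟩ := ((deep_smul (H := H) (u := s) (s := s) (fun _ _ h => h) (fun _ _ h => h) R).and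
      (eventually_ge_atTop ((k : ℝ) * (1 + ∑ i, |v k i|)))).exists
    exact ⟨r, h2, hR _ h1⟩
  choose r hr x hxV hx hxz using hex
  set θ : ℕ → Fin n → ℝ := fun k => lgv (x k).1 + r k • s - v k with hθ
  have hθ0 : Tendsto θ atTop (𝓝 0) := tendsto_of_lt (fun k i => by
    have := (hx k i).le
    simpa [hθ] using this)
  have hθw : ∀ w, Tendsto (fun k => dotR w (θ k)) atTop (𝓝 0) := fun w => by
    have := ((continuous_dotR w).tendsto _).comp hθ0
    rwa [dotR_zero] at this
  have hform : ∀ w k, mPow (x k).1 w = Real.exp (dotR w (θ k)) *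
      Real.exp (dotR w (v k) - r k * dotR w s) := by
    intro w k
    rw [mPow_eq (hpos _ (hxV k)), ← Real.exp_add, hθ, dotR_sub, dotR_add, dotR_smul]
    congr 1; ring
  have hperpcase : ∀ w (hw : w ∈ perpSet (cell H s)), ∀ L, Tendsto (fun k => (ψ k).1 ⟨w, hw⟩) atTop (𝓝 L) →
      Tendsto (fun k => mPow (x k).1 w) atTop (𝓝 L) := by
    intro w hw L hL
    have h3 := ((Real.continuous_exp.tendsto _).comp (hθw w)).mul hL
    rw [Real.exp_zero, one_mul] at h3
    refine h3.congr (fun k => ?_)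
    rw [hform, hv, hw s cell_self, mul_zero, sub_zero, dotR_comm (v k)]
    rfl
  refine ⟨hφ, x, hxV, ?_, fun w hw hw' => ?_, fun w hw hw' => ?_⟩
  · have h3 : Tendsto (fun k => (x k).2 - (ψ k).2) atTop (𝓝 0) := tendsto_of_lt (fun k i => by
      have := (hxz k i).le
      simpa using this)
    have h4 := h3.add hz
    rw [zero_add] at h4
    exact h4.congr (fun k => by simp)
  · have hws : w ∈ perpSet (cell H s) := fun c hc => hw' c (hst hc)
    exact hperpcase w hws _ (h1 w hw hws hw')
  · by_cases hws : w ∈ perpSet (cell H s)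
    · exact hperpcase w hws _ (h2 w hw hws hw')
    · have hp : 0 < dotR w s := cell_dual_pos Hs (fun c hc => hw c (hst hc)) hws
      have h3 : Tendsto (fun k => dotR w (v k) - r k * dotR w s) atTop atBot := by
        have h4 : Tendsto (fun k : ℕ => - ((k : ℝ) * dotR w s)) atTop atBot :=
          tendsto_neg_atTop_atBot.comp (tendsto_natCast_atTop_atTop.atTop_mul_const hp)
        refine tendsto_atBot_mono' _ ?_ h4
        have h5 : Tendsto (fun k : ℕ => (k : ℝ) * dotR w s) atTop atTop :=
          tendsto_natCast_atTop_atTop.atTop_mul_const hp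
        filter_upwards [h5.eventually (eventually_ge_atTop (∑ i, |w i|))] with k hk
        have h6 := (abs_le.1 (abs_dotR_le w (v k))).2
        have h7 := mul_le_mul_of_nonneg_right (hr k) hp.le
        have h8 : (0 : ℝ) ≤ ∑ i, |v k i| := Finset.sum_nonneg (fun _ _ => abs_nonneg _)
        have h9 := mul_le_mul_of_nonneg_right hk h8
        nlinarith
      have h4 := ((Real.continuous_exp.tendsto _).comp (hθw w)).mul (Real.tendsto_exp_comp_nhds_zero.2 h3)
      rw [mul_zero] at h4
      exact h4.congr (fun k => (hform w k).symm)

lemma part1a (hpos : ∀ x ∈ V, ∀ i, 0 < x.1 i) (Hs : ∀ h ∈ H, -h ∈ H) (hK : KeyP V H)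
    (s t : Fin n → ℝ) (hst : cell H s ⊆ cell H t) :
    limitSet m (cell H t) V ⊆ relLimitSet m (cell H s) (cell H t) (limitSet m (cell H s) V) := by
  rintro ⟨φ, z⟩ hL
  obtain ⟨v, hv⟩ := hL.1
  dsimp only at hv
  have hA := lemA hpos Hs hK hv hL
  have hs : s ∈ cell H t := hst cell_self
  have hex : ∀ k : ℕ, ∃ r : ℝ, (k : ℝ) ≤ r ∧ ∀ j : ℕ, Appr V v z (1 / ((k : ℝ) + 1)) (r • t + (j : ℝ) • s) := by
    intro k
    obtain ⟨R, hR⟩ := hA (1 / ((k : ℝ) + 1)) (by positivity)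
    obtain ⟨r, h1, h2⟩ := ((deep_smul (H := H) (u := t) (s := t) (fun _ _ h => h) (fun _ _ h => h) R).and
      (eventually_ge_atTop (k : ℝ))).exists
    refine ⟨r, h2, fun j => hR _ (fun h hh => ⟨fun h0 => ?_, fun h0 => ?_⟩)⟩
    · rw [pr_add, (h1 h hh).1 h0, pr_smul, cell_eq0 Hs hs hh h0]; simp
    · rw [pr_add, pr_smul _ (j : ℝ)]
      have := (h1 h hh).2 h0
      have := mul_nonneg (Nat.cast_nonneg (α := ℝ) j) (hs h hh h0.le)
      linarith
  choose r hr hAp using hex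
  have hk : ∀ k : ℕ, ∃ (b : Fin n → ℝ) (ζ : Fin m → ℝ), (∀ i, |b i| ≤ 1 / ((k : ℝ) + 1)) ∧
      (∀ i, |ζ i| ≤ 1 / ((k : ℝ) + 1)) ∧
      ((fun w : ↥(perpSet (cell H s)) => Real.exp (dotR (v - r k • t + b) (w : Fin n → ℝ))), z + ζ) ∈
        limitSet m (cell H s) V := by
    intro k
    choose x hxV hx hz using hAp k
    have hη : (0 : ℝ) ≤ 1 / ((k : ℝ) + 1) := by positivity
    let q : ℕ → (Fin n → ℝ) × (Fin m → ℝ) := fun j =>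
      (lgv (x j).1 + (r k • t + (j : ℝ) • s) - v, (x j).2 - z)
    have hq : ∀ j, q j ∈ Metric.closedBall (0 : (Fin n → ℝ) × (Fin m → ℝ)) (1 / ((k : ℝ) + 1)) := by
      intro j
      rw [mem_closedBall_zero_iff, Prod.norm_def]
      refine max_le ((pi_norm_le_iff_of_nonneg hη).2 (fun i => ?_)) ((pi_norm_le_iff_of_nonneg hη).2 (fun i => ?_))
      · exact (hx j i).le
      · exact (hz j i).le
    obtain ⟨⟨b, ζ⟩, hmem, ρ, hρ, hlim⟩ := (isCompact_closedBall _ _).tendsto_subseq hq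
    rw [mem_closedBall_zero_iff, Prod.norm_def] at hmem
    have hm1 := (pi_norm_le_iff_of_nonneg hη).1 ((le_max_left _ _).trans hmem)
    have hm2 := (pi_norm_le_iff_of_nonneg hη).1 ((le_max_right _ _).trans hmem)
    have hl1 : Tendsto (fun j => (q (ρ j)).1) atTop (𝓝 b) := (continuous_fst.tendsto _).comp hlim
    have hl2 : Tendsto (fun j => (q (ρ j)).2) atTop (𝓝 ζ) := (continuous_snd.tendsto _).comp hlim
    refine ⟨b, ζ, hm1, hm2, ?_⟩
    refine limit_of hpos (fun j => x (ρ j)) (fun j => hxV _) ?_ (fun j => ((ρ j : ℕ) : ℝ) • s) ?_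
      (fun w hw j => ?_) (fun w hw hw' => ?_)
    · refine (hl2.const_add z).congr (fun j => ?_)
      simp [q]
    · refine (hl1.const_add (v - r k • t)).congr (fun j => ?_)
      simp only [q]; abel
    · rw [dotR_smul, hw s cell_self, mul_zero]
    · simp only [dotR_smul]
      exact (tendsto_natCast_atTop_atTop.comp hρ.tendsto_atTop).atTop_mul_const (cell_dual_pos Hs hw hw')
  choose b ζ hb hζ hmem using hk
  have hb0 : Tendsto b atTop (𝓝 0) := tendsto_of_lt (fun k i => by simpa using hb k i)
  have hζ0 : Tendsto ζ atTop (𝓝 0) := tendsto_of_lt (fun k i => by simpa using hζ k i)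
  have hlw : ∀ w, Tendsto (fun k => dotR w (v + b k)) atTop (𝓝 (dotR w v)) := by
    intro w
    have := ((continuous_dotR w).tendsto _).comp (hb0.const_add v)
    rwa [add_zero] at this
  have hform : ∀ (w : Fin n → ℝ) k, dotR (v - r k • t + b k) w = dotR w (v + b k) - r k * dotR w t := by
    intro w k
    rw [dotR_comm, dotR_add, dotR_sub, dotR_add, dotR_smul]; ring
  refine ⟨⟨v, hv⟩, _, hmem, ?_, fun w hw hwσ hwτ => ?_, fun w hw hwσ hwτ => ?_⟩
  · have := hζ0.const_add z
    rw [add_zero] at this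
    exact this
  · dsimp only
    rw [hv]
    dsimp only
    rw [dotR_comm v w]
    refine ((Real.continuous_exp.tendsto _).comp (hlw w)).congr (fun k => ?_)
    rw [hform, hwτ t cell_self, mul_zero, sub_zero]
    rfl
  · dsimp only
    have hp := cell_dual_pos Hs hw hwτ
    refine Real.tendsto_exp_comp_nhds_zero.2 ?_
    simp only [hform]
    simp only [sub_eq_add_neg]
    exact (hlw w).add_atBot (tendsto_neg_atTop_atBot.comp
      ((tendsto_atTop_mono hr tendsto_natCast_atTop_atTop).atTop_mul_const hp))
end

end

/-- Let `V ⊆ ℝ_{>0}^n × ℝ^m` be a closed semialgebraic set. Then there is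
a finite fan `Σ` of strongly convex rational polyhedral cones (closed under faces, with
pairwise intersections being faces) whose support is `Trop(V)`, such that
(1) for all `σ ⊆ τ` in `Σ`, `L_τ(V) = L_{σ,τ}(L_σ(V))`; and
(2) for every `σ ∈ Σ` and every strongly convex (possibly non-rational) cone `σ' ⊆ σ`
meeting `relint σ`, `L_{σ'}(V)` is the preimage of `L_σ(V)` inside `O(σ')(ℝ_{>0}) × ℝ^m`
under `ρ_{σ',σ} × id`. -/
theorem stmt_5 (n m : ℕ) (V : Set ((Fin n → ℝ) × (Fin m → ℝ)))
    (hV : IsClosedSemialgebraicInOrthant n m V) :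
    ∃ Sig : Set (Set (Fin n → ℝ)), Sig.Finite ∧
      (∀ σ ∈ Sig, IsRatPolyCone σ ∧ ∀ x ∈ σ, -x ∈ σ → x = 0) ∧
      (∀ σ ∈ Sig, ∀ F, IsFaceOf F σ → F ∈ Sig) ∧
      (∀ σ ∈ Sig, ∀ τ ∈ Sig, IsFaceOf (σ ∩ τ) σ ∧ IsFaceOf (σ ∩ τ) τ) ∧
      ⋃₀ Sig = tropSet n m V ∧
      (∀ σ ∈ Sig, ∀ τ ∈ Sig, σ ⊆ τ →
        limitSet m τ V = relLimitSet m σ τ (limitSet m σ V)) ∧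
      (∀ σ ∈ Sig, ∀ σ' : Set (Fin n → ℝ), IsSCCone σ' → ∀ hsub : σ' ⊆ σ,
        (σ' ∩ intrinsicInterior ℝ σ).Nonempty →
        limitSet m σ' V =
          {p : (↥(perpSet σ') → ℝ) × (Fin m → ℝ) | p.1 ∈ orbitSet σ'} ∩
            (fun p : (↥(perpSet σ') → ℝ) × (Fin m → ℝ) =>
              (restrictOrbit σ' σ hsub p.1, p.2)) ⁻¹' limitSet m σ V) := by
  have hpos : ∀ x ∈ V, ∀ i, 0 < x.1 i := by
    obtain ⟨W, _, rfl⟩ := hV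
    exact fun x hx => hx.1
  obtain ⟨H, Hs, He, hK⟩ := key hV
  have hK : KeyP V H := hK
  refine ⟨(cell H) '' tropSet n m V, ?_, ?_, ?_, ?_, ?_, ?_, ?_⟩
  · refine (H.powerset.finite_toSet.image pc).subset ?_
    rintro _ ⟨u, _, rfl⟩
    obtain ⟨L, hL, e⟩ := cell_eq_pc H u
    exact ⟨L, hL, e.symm⟩
  · rintro _ ⟨u, _, rfl⟩
    obtain ⟨L, hL, e⟩ := cell_eq_pc H u
    refine ⟨by rw [e]; exact pc_rat L, fun x hx hx' => cell_sc Hs He hx hx'⟩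
  · rintro _ ⟨u, hu, rfl⟩ F hF
    obtain ⟨u0, hu0, rfl⟩ := cell_face Hs hF
    exact ⟨u0, trop_cell hpos Hs hK hu hu0, rfl⟩
  · rintro _ ⟨u, hu, rfl⟩ _ ⟨u', hu', rfl⟩
    exact ⟨cell_inter Hs u u', by rw [Set.inter_comm]; exact cell_inter Hs u' u⟩
  · ext c
    constructor
    · rintro ⟨_, ⟨u, hu, rfl⟩, hc⟩
      exact trop_cell hpos Hs hK hu hc
    · intro hc
      exact ⟨_, ⟨c, hc, rfl⟩, cell_self⟩
  · rintro _ ⟨s, _, rfl⟩ _ ⟨t, _, rfl⟩ hst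
    exact Set.Subset.antisymm (part1a hpos Hs hK s t hst) (part1b hpos Hs hK s t hst)
  · rintro _ ⟨u, _, rfl⟩ σ' hσ' hsub hne
    exact part2 hpos Hs hK u σ' hσ' hsub hne
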